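/- Let Ω ⊂ ℝ^d (d ≥ 2) be a nonempty bounded convex open set, and let (Ω_k)_{k≥1} be a sequence of bounded open sets with Ω ⊆ Ω_k for all k ≥ 1. Then liminf_{k→∞} μ_k(Ω)/μ_k(Ω_k) ≥ 1; precisely, for every ε > 0 there exists K such that for all k ≥ K, μ_k(Ω) ≥ (1 − ε)·μ_k(Ω_k). -/

import Mathlib

open MeasureTheory Real Filter

noncomputable section

/-- Euclidean space `ℝ^d`. -/
abbrev Euc (d : ℕ) := EuclideanSpace ℝ (Fin d)

/-- The Rayleigh quotient of a function `u` on a set `Ω ⊆ ℝ^d`. -/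
noncomputable def rayleigh {d : ℕ} (Ω : Set (Euc d)) (u : Euc d → ℝ) : ℝ :=
  (∫ x in Ω, ‖fderiv ℝ u x‖ ^ 2) / (∫ x in Ω, (u x) ^ 2)

/-- The `k`-th Neumann eigenvalue of `Ω ⊆ ℝ^d`, defined by the variational (min-max)
principle: the infimum, over all subspaces `V` of smooth functions `ℝ^d → ℝ` whose space of
restrictions to `Ω` is `(k+1)`-dimensional, of the supremum of the Rayleigh quotient over
the elements of `V` that are nonzero in `L²(Ω)`. -/
noncomputable def neumannEigenvalue {d : ℕ} (k : ℕ) (Ω : Set (Euc d)) : ℝ :=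
  sInf { t : ℝ | ∃ V : Submodule ℝ (Euc d → ℝ),
    (∀ u ∈ V, ContDiff ℝ (⊤ : ℕ∞) u) ∧
    Module.finrank ℝ (V.map (LinearMap.funLeft ℝ ℝ ((↑) : Ω → Euc d))) = k + 1 ∧
    t = sSup { r : ℝ | ∃ u ∈ V, (0 < ∫ x in Ω, (u x) ^ 2) ∧ r = rayleigh Ω u } }

/-- A nonempty bounded convex open subset of `ℝ^d`. -/
def IsConvexDomain {d : ℕ} (Ω : Set (Euc d)) : Prop :=
  Ω.Nonempty ∧ IsOpen Ω ∧ Bornology.IsBounded Ω ∧ Convex ℝ Ω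

/-- The optimal constant `α_{k,d}`: the infimum of `μ_k(Ω₁)/μ_k(Ω₂)` over all pairs of
nonempty bounded convex open sets `Ω₁ ⊆ Ω₂ ⊂ ℝ^d`. -/
noncomputable def alphaConst (k d : ℕ) : ℝ :=
  sInf { r : ℝ | ∃ Ω₁ Ω₂ : Set (Euc d), IsConvexDomain Ω₁ ∧ IsConvexDomain Ω₂ ∧ Ω₁ ⊆ Ω₂ ∧
    r = neumannEigenvalue k Ω₁ / neumannEigenvalue k Ω₂ }

/-- The Bessel function of the first kind of order `ν` (for `x > 0`). -/
noncomputable def besselJ (ν : ℝ) (x : ℝ) : ℝ :=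
  ∑' m : ℕ, ((-1 : ℝ) ^ m / (m.factorial * Real.Gamma (m + ν + 1))) * (x / 2) ^ (2 * (m : ℝ) + ν)

/-- The first positive zero `j_{ν,1}` of the Bessel function `J_ν`. -/
noncomputable def besselZero1 (ν : ℝ) : ℝ :=
  sInf {x : ℝ | 0 < x ∧ besselJ ν x = 0}

/-- The second positive zero `j_{ν,2}` of the Bessel function `J_ν`. -/
noncomputable def besselZero2 (ν : ℝ) : ℝ :=
  sInf {x : ℝ | besselZero1 ν < x ∧ besselJ ν x = 0}


/-- pointwise line estimate -/
lemma line_est {d : ℕ} (u : Euc d → ℝ) (hu : ContDiff ℝ (⊤ : ℕ∞) u) (x y : Euc d) :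
    (u y - u x) ^ 2 ≤ ‖y - x‖ ^ 2 * ∫ t in (0:ℝ)..1, ‖fderiv ℝ u (x + t • (y - x))‖ ^ 2 := by
  have hd : ∀ z, HasFDerivAt u (fderiv ℝ u z) z := fun z =>
    (hu.differentiable (by simp) z).hasFDerivAt
  have hcf : Continuous (fderiv ℝ u) := hu.continuous_fderiv (by simp)
  have hline : Continuous (fun t : ℝ => x + t • (y - x)) := by fun_prop
  have hder : ∀ t ∈ Set.uIcc (0:ℝ) 1, HasDerivAt (fun t : ℝ => u (x + t • (y - x)))
      (fderiv ℝ u (x + t • (y - x)) (y - x)) t := by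
    intro t _
    have h1 : HasDerivAt (fun t : ℝ => x + t • (y - x)) (y - x) t := by
      simpa using ((hasDerivAt_id t).smul_const (y - x)).const_add x
    exact (hd _).comp_hasDerivAt t h1
  have hc1 : Continuous (fun t : ℝ => fderiv ℝ u (x + t • (y - x)) (y - x)) :=
    (hcf.comp hline).clm_apply continuous_const
  have hc2 : Continuous (fun t : ℝ => ‖fderiv ℝ u (x + t • (y - x))‖) :=
    (hcf.comp hline).norm
  have hftc := intervalIntegral.integral_eq_sub_of_hasDerivAt hder (hc1.intervalIntegrable _ _)
  simp only [one_smul, zero_smul, add_zero, add_sub_cancel] at hftc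
  set I := ∫ t in (0:ℝ)..1, ‖fderiv ℝ u (x + t • (y - x))‖ with hI
  set I2 := ∫ t in (0:ℝ)..1, ‖fderiv ℝ u (x + t • (y - x))‖ ^ 2 with hI2
  have hb : |u y - u x| ≤ ‖y - x‖ * I := by
    rw [← hftc, hI, ← intervalIntegral.integral_const_mul]
    rw [← Real.norm_eq_abs]
    apply intervalIntegral.norm_integral_le_of_norm_le (by norm_num)
    · refine Eventually.of_forall fun t _ => ?_
      rw [mul_comm]; exact ContinuousLinearMap.le_opNorm _ _
    · exact (continuous_const.mul hc2).intervalIntegrable _ _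
  have hJ : I ^ 2 ≤ I2 := by
    have h0 : 0 ≤ ∫ t in (0:ℝ)..1, (‖fderiv ℝ u (x + t • (y - x))‖ - I) ^ 2 :=
      intervalIntegral.integral_nonneg (by norm_num) fun t _ => sq_nonneg _
    have h1 : (∫ t in (0:ℝ)..1, (‖fderiv ℝ u (x + t • (y - x))‖ - I) ^ 2) = I2 - 2 * I * I + I ^ 2 := by
      have : ∀ t : ℝ, (‖fderiv ℝ u (x + t • (y - x))‖ - I) ^ 2 =
        ‖fderiv ℝ u (x + t • (y - x))‖ ^ 2 - 2 * I * ‖fderiv ℝ u (x + t • (y - x))‖ + I ^ 2 := by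
        intro t; ring
      simp_rw [this]
      rw [intervalIntegral.integral_add, intervalIntegral.integral_sub,
        intervalIntegral.integral_const_mul]
      · simp [hI, hI2]
      · exact (hc2.pow 2).intervalIntegrable _ _
      · exact (continuous_const.mul hc2).intervalIntegrable _ _
      · exact ((hc2.pow 2).sub (continuous_const.mul hc2)).intervalIntegrable _ _
      · exact continuous_const.intervalIntegrable _ _
    nlinarith
  calc (u y - u x) ^ 2 = |u y - u x| ^ 2 := (sq_abs _).symm
    _ ≤ (‖y - x‖ * I) ^ 2 := by gcongr
    _ = ‖y - x‖ ^ 2 * I ^ 2 := by ring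
    _ ≤ _ := by gcongr

/-- change of variables bound -/
lemma cov_est {d : ℕ} (C : Set (Euc d)) (hC : Convex ℝ C) (hm : MeasurableSet C)
    (F : Euc d → ENNReal) (y : Euc d) (hy : y ∈ C) (t : ℝ) (ht : 1 / 2 ≤ t)
    (ht1 : t ≤ 1) :
    ∫⁻ x in C, F (t • x + (1 - t) • y) ≤ 2 ^ d * ∫⁻ x in C, F x := by
  have ht0 : (0:ℝ) < t := by linarith
  set v := (1 - t) • y with hv
  have h1 : ∫⁻ x in C, F (t • x + v) ≤ ∫⁻ x, (C.indicator F) (t • x + v) := by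
    rw [← lintegral_indicator hm]
    apply lintegral_mono
    intro x
    by_cases hx : x ∈ C
    · have : t • x + v ∈ C := hC hx hy ht0.le (by linarith) (by ring)
      simp [hx, this]
    · simp [hx]
  refine h1.trans ?_
  have h2 : ∫⁻ x, (C.indicator F) (t • x + v) = ENNReal.ofReal |(t ^ d)⁻¹| * ∫⁻ x, (C.indicator F) x := by
    have e := Measure.map_addHaar_smul (volume : Measure (Euc d)) (r := t) ht0.ne'
    have e2 : ∫⁻ x, (C.indicator F) (t • x + v) =
        ∫⁻ x, (C.indicator F) (x + v) ∂(Measure.map (fun x => t • x) (volume : Measure (Euc d))) := by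
      have := lintegral_map_equiv (μ := (volume : Measure (Euc d))) (fun x => (C.indicator F) (x + v))
        (MeasurableEquiv.smul₀ (α := Euc d) t ht0.ne')
      rw [← MeasurableEquiv.coe_smul₀ ht0.ne', this]
      rfl
    rw [e2, e, lintegral_smul_measure, lintegral_add_right_eq_self]
    simp
  rw [h2, lintegral_indicator hm]
  gcongr
  rw [abs_of_pos (by positivity)]
  have : (t ^ d)⁻¹ ≤ 2 ^ d := by
    rw [← inv_pow]
    have : t⁻¹ ≤ 2 := by rw [inv_le_comm₀ ht0 (by norm_num)]; linarith
    gcongr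
  calc ENNReal.ofReal (t ^ d)⁻¹ ≤ ENNReal.ofReal (2 ^ d) := ENNReal.ofReal_le_ofReal this
    _ = 2 ^ d := by rw [ENNReal.ofReal_pow (by norm_num)]; simp

lemma smooth_intOn {d : ℕ} {C : Set (Euc d)} (hb : Bornology.IsBounded C) {f : Euc d → ℝ}
    (hf : Continuous f) : IntegrableOn f C :=
  ((hf.continuousOn.integrableOn_compact hb.isCompact_closure)).mono_set subset_closure

lemma cont_g {d : ℕ} {u : Euc d → ℝ} (hu : ContDiff ℝ (⊤ : ℕ∞) u) :
    Continuous (fun x => ‖fderiv ℝ u x‖ ^ 2) :=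
  ((hu.continuous_fderiv (by simp)).norm).pow 2

/-- double integral bound -/
lemma dbl_est {d : ℕ} (C : Set (Euc d)) (hC : Convex ℝ C) (hm : MeasurableSet C)
    (F : Euc d → ENNReal) (hF : Measurable F) (t : ℝ) (ht0 : 0 ≤ t) (ht1 : t ≤ 1) :
    ∫⁻ x in C, ∫⁻ y in C, F (x + t • (y - x)) ≤ volume C * (2 ^ d * ∫⁻ x in C, F x) := by
  have key : ∀ t : ℝ, 1 / 2 ≤ t → t ≤ 1 →
      ∫⁻ x in C, ∫⁻ y in C, F (t • y + (1 - t) • x) ≤ volume C * (2 ^ d * ∫⁻ x in C, F x) := by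
    intro t h1 h2
    calc ∫⁻ x in C, ∫⁻ y in C, F (t • y + (1 - t) • x)
        ≤ ∫⁻ x in C, (2 ^ d * ∫⁻ x in C, F x) :=
          setLIntegral_mono' hm fun x hx => cov_est C hC hm F x hx t h1 h2
      _ = _ := by rw [setLIntegral_const, mul_comm]
  rcases le_total (1 / 2) t with h | h
  · refine le_trans (le_of_eq ?_) (key t h ht1)
    congr 1; ext x; congr 1; ext y; congr 1; module
  · refine le_trans (le_of_eq ?_) (key (1 - t) (by linarith) (by linarith))
    rw [lintegral_lintegral_swap]
    · congr 1; ext x; congr 1; ext y; congr 1; module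
    · apply Measurable.aemeasurable
      apply hF.comp
      fun_prop

lemma poincare {d : ℕ} (C : Set (Euc d)) (hC : Convex ℝ C) (hm : MeasurableSet C)
    (D : ℝ) (hb : Bornology.IsBounded C) (hD : ∀ x ∈ C, ∀ y ∈ C, ‖y - x‖ ≤ D)
    (u : Euc d → ℝ) (hu : ContDiff ℝ (⊤ : ℕ∞) u) (h0 : ∫ x in C, u x = 0) :
    ∫ x in C, u x ^ 2 ≤ 2 ^ d * D ^ 2 * ∫ x in C, ‖fderiv ℝ u x‖ ^ 2 := by
  have hfin : volume C ≠ ⊤ := hb.measure_lt_top.ne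
  by_cases hz : volume C = 0
  · rw [Measure.restrict_eq_zero.2 hz]; simp
  have hD0 : 0 ≤ D := by
    obtain ⟨x, hx⟩ := nonempty_of_measure_ne_zero hz
    simpa using hD x hx x hx
  have hcu : Continuous u := hu.continuous
  have hcg := cont_g hu
  set F : Euc d → ENNReal := fun x => ENNReal.ofReal (‖fderiv ℝ u x‖ ^ 2) with hFdef
  have hF : Measurable F := (ENNReal.continuous_ofReal.comp hcg).measurable
  have hup : ∫⁻ x in C, ∫⁻ y in C, ENNReal.ofReal ((u y - u x) ^ 2) ≤
      ENNReal.ofReal (D ^ 2) * (volume C * (2 ^ d * ∫⁻ x in C, F x)) := by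
    calc ∫⁻ x in C, ∫⁻ y in C, ENNReal.ofReal ((u y - u x) ^ 2)
        ≤ ∫⁻ x in C, ∫⁻ y in C, ENNReal.ofReal (D ^ 2) *
            ∫⁻ t in Set.Ioc (0:ℝ) 1, F (x + t • (y - x)) := by
          refine setLIntegral_mono' hm fun x hx => setLIntegral_mono' hm fun y hy => ?_
          have hci : Continuous (fun t : ℝ => ‖fderiv ℝ u (x + t • (y - x))‖ ^ 2) :=
            hcg.comp (by fun_prop : Continuous (fun t : ℝ => x + t • (y - x)))
          have h1 := line_est u hu x y
          rw [intervalIntegral.integral_of_le (by norm_num)] at h1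
          rw [hFdef]
          rw [← ofReal_integral_eq_lintegral_ofReal, ← ENNReal.ofReal_mul (by positivity)]
          · apply ENNReal.ofReal_le_ofReal
            refine h1.trans ?_
            have := hD x hx y hy
            have h3 : 0 ≤ ∫ t in Set.Ioc (0:ℝ) 1, ‖fderiv ℝ u (x + t • (y - x))‖ ^ 2 :=
              integral_nonneg fun t => by positivity
            gcongr
          · exact (hci.continuousOn.integrableOn_compact isCompact_Icc).mono_set
              Set.Ioc_subset_Icc_self
          · exact Eventually.of_forall fun t => by positivity
      _ = ENNReal.ofReal (D ^ 2) * ∫⁻ t in Set.Ioc (0:ℝ) 1,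
            ∫⁻ x in C, ∫⁻ y in C, F (x + t • (y - x)) := by
          have hmeas3 : Measurable (fun p : (Euc d × ℝ) × Euc d =>
              F (p.1.1 + p.1.2 • (p.2 - p.1.1))) := hF.comp (by fun_prop)
          simp_rw [lintegral_const_mul' _ _ ENNReal.ofReal_ne_top]
          congr 1
          rw [lintegral_lintegral_swap (f := fun (t : ℝ) (x : Euc d) => ∫⁻ y in C, F (x + t • (y - x)))]
          · refine lintegral_congr fun x => ?_
            rw [lintegral_lintegral_swap]
            apply Measurable.aemeasurable
            exact hF.comp (by fun_prop)
          · apply Measurable.aemeasurable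
            have h4 : Measurable (fun p : (ℝ × Euc d) × Euc d =>
              F (p.1.2 + p.1.1 • (p.2 - p.1.2))) := hF.comp (by fun_prop)
            exact h4.lintegral_prod_right'
      _ ≤ ENNReal.ofReal (D ^ 2) * ∫⁻ t in Set.Ioc (0:ℝ) 1,
            (volume C * (2 ^ d * ∫⁻ x in C, F x)) := by
          refine mul_le_mul_right ?_ _
          exact setLIntegral_mono' measurableSet_Ioc fun t ht =>
            dbl_est C hC hm F hF t ht.1.le ht.2
      _ = _ := by simp
  have hlow : volume C * ∫⁻ x in C, ENNReal.ofReal (u x ^ 2) ≤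
      ∫⁻ x in C, ∫⁻ y in C, ENNReal.ofReal ((u y - u x) ^ 2) := by
    rw [← lintegral_const_mul' _ _ hfin]
    refine lintegral_mono fun x => ?_
    rw [← ofReal_integral_eq_lintegral_ofReal]
    · have e : ∀ y, (u y - u x) ^ 2 = u y ^ 2 - 2 * u x * u y + u x ^ 2 := fun y => by ring
      simp_rw [e]
      have hi1 : IntegrableOn (fun y => u y ^ 2) C := smooth_intOn hb (by fun_prop)
      have hi2 : IntegrableOn (fun y => 2 * u x * u y) C := smooth_intOn hb (by fun_prop)
      have hi3 : IntegrableOn (fun y => u x ^ 2) C := smooth_intOn hb (by fun_prop)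
      have hi4 : IntegrableOn (fun y => u y ^ 2 - 2 * u x * u y) C := smooth_intOn hb (by fun_prop)
      rw [integral_add hi4 hi3, integral_sub hi1 hi2, integral_const_mul, h0]
      rw [setIntegral_const, smul_eq_mul]
      have h5 : 0 ≤ ∫ y in C, u y ^ 2 := integral_nonneg fun y => by positivity
      have h6 : volume C = ENNReal.ofReal (volume.real C) := by
        rw [Measure.real, ENNReal.ofReal_toReal hfin]
      rw [h6, ← ENNReal.ofReal_mul (by positivity)]
      apply ENNReal.ofReal_le_ofReal
      linarith
    · exact smooth_intOn hb (by fun_prop)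
    · exact Eventually.of_forall fun t => by positivity
  have hall := hlow.trans hup
  have hall2 : ∫⁻ x in C, ENNReal.ofReal (u x ^ 2) ≤
      ENNReal.ofReal (D ^ 2) * (2 ^ d * ∫⁻ x in C, F x) := by
    rw [← ENNReal.mul_le_mul_iff_right hz hfin]
    refine hall.trans (le_of_eq (by ring))
  rw [hFdef, ← ofReal_integral_eq_lintegral_ofReal (smooth_intOn hb (by fun_prop))
    (Eventually.of_forall fun t => by positivity),
    ← ofReal_integral_eq_lintegral_ofReal (smooth_intOn hb hcg)
    (Eventually.of_forall fun t => by positivity)] at hall2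
  have h2 : (2:ENNReal) ^ d = ENNReal.ofReal (2 ^ d) := by
    rw [ENNReal.ofReal_pow (by norm_num)]; simp
  have h7 : 0 ≤ ∫ x in C, ‖fderiv ℝ u x‖ ^ 2 := integral_nonneg fun t => by positivity
  rw [h2, ← ENNReal.ofReal_mul (by positivity), ← ENNReal.ofReal_mul (by positivity),
    ENNReal.ofReal_le_ofReal_iff (by positivity)] at hall2
  linarith

/-- Grid cell of side `s` -/
def gcell {d : ℕ} (s : ℝ) (j : Fin d → ℤ) : Set (Euc d) := {x | ∀ i, ⌊x i / s⌋ = j i}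

lemma gcell_eq {d : ℕ} {s : ℝ} (hs : 0 < s) (j : Fin d → ℤ) :
    gcell s j = (WithLp.ofLp : Euc d → (Fin d → ℝ)) ⁻¹'
      (Set.univ.pi fun i => Set.Ico (s * j i) (s * j i + s)) := by
  ext x
  simp only [gcell, Set.mem_ofPred_eq, Set.mem_preimage, Set.mem_pi, Set.mem_univ, forall_true_left,
    Set.mem_Ico]
  refine forall_congr' fun i => ?_
  rw [Int.floor_eq_iff, le_div_iff₀ hs, div_lt_iff₀ hs]
  constructor <;> rintro ⟨h1, h2⟩ <;> constructor <;> linarith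

lemma gcell_meas {d : ℕ} {s : ℝ} (hs : 0 < s) (j : Fin d → ℤ) :
    MeasurableSet (gcell s j : Set (Euc d)) := by
  rw [gcell_eq hs]
  exact (PiLp.volume_preserving_ofLp (Fin d)).measurable
    (MeasurableSet.univ_pi fun i => measurableSet_Ico)

lemma gcell_vol {d : ℕ} {s : ℝ} (hs : 0 < s) (j : Fin d → ℤ) :
    volume (gcell s j : Set (Euc d)) = ENNReal.ofReal (s ^ d) := by
  rw [gcell_eq hs, (PiLp.volume_preserving_ofLp (Fin d)).measure_preimage
    (MeasurableSet.univ_pi fun i => measurableSet_Ico).nullMeasurableSet, volume_pi_pi]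
  simp [ENNReal.ofReal_pow hs.le]

lemma gcell_convex {d : ℕ} {s : ℝ} (hs : 0 < s) (j : Fin d → ℤ) :
    Convex ℝ (gcell s j : Set (Euc d)) := by
  rw [gcell_eq hs]
  have h : Convex ℝ (Set.univ.pi fun i : Fin d => Set.Ico (s * (j i : ℝ)) (s * j i + s)) :=
    convex_pi fun i _ => convex_Ico _ _
  exact h.linear_preimage (WithLp.linearEquiv 2 ℝ (Fin d → ℝ)).toLinearMap

lemma gcell_norm {d : ℕ} {s : ℝ} (hs : 0 < s) (j : Fin d → ℤ) (x y : Euc d)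
    (hx : x ∈ gcell s j) (hy : y ∈ gcell s j) : ‖y - x‖ ≤ s * √d := by
  rw [gcell_eq hs] at hx hy
  rw [EuclideanSpace.norm_eq]
  have : ∑ i, ‖(y - x) i‖ ^ 2 ≤ s ^ 2 * d := by
    calc ∑ i, ‖(y - x) i‖ ^ 2 ≤ ∑ i : Fin d, s ^ 2 := by
          apply Finset.sum_le_sum
          intro i _
          have h1 := hx i (Set.mem_univ _)
          have h2 := hy i (Set.mem_univ _)
          simp only [Set.mem_Ico] at h1 h2
          have : ‖(y - x) i‖ ≤ s := by
            rw [Real.norm_eq_abs, PiLp.sub_apply, abs_le]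
            constructor <;> linarith
          gcongr
      _ = s ^ 2 * d := by simp [mul_comm]
  calc √(∑ i, ‖(y - x) i‖ ^ 2) ≤ √(s ^ 2 * d) := Real.sqrt_le_sqrt this
    _ = s * √d := by rw [Real.sqrt_mul (by positivity), Real.sqrt_sq hs.le]

lemma gcell_disj {d : ℕ} {s : ℝ} : Pairwise (Function.onFun Disjoint (gcell s : (Fin d → ℤ) → Set (Euc d))) := by
  intro j j' hne
  rw [Function.onFun, Set.disjoint_left]
  intro x hx hx'
  exact hne (funext fun i => (hx i).symm.trans (hx' i))

lemma layer_poincare {d : ℕ} (Ω : Set (Euc d)) (hc : Convex ℝ Ω) (ho : IsOpen Ω)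
    (hb : Bornology.IsBounded Ω) {s : ℝ} (hs : 0 < s) (L : Set (Euc d)) (hL : L ⊆ Ω)
    (J : Finset (Fin d → ℤ)) (hJ : ∀ x ∈ L, ∃ j ∈ J, x ∈ gcell s j)
    (u : Euc d → ℝ) (hu : ContDiff ℝ (⊤ : ℕ∞) u)
    (h0 : ∀ j ∈ J, ∫ x in gcell s j ∩ Ω, u x = 0) :
    ∫ x in L, u x ^ 2 ≤ 2 ^ d * d * s ^ 2 * ∫ x in Ω, ‖fderiv ℝ u x‖ ^ 2 := by
  have hcu : Continuous u := hu.continuous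
  have hm : ∀ j, MeasurableSet (gcell s j ∩ Ω) := fun j => (gcell_meas hs j).inter ho.measurableSet
  have hdj : (J : Set (Fin d → ℤ)).PairwiseDisjoint (fun j => gcell s j ∩ Ω) := by
    intro j _ j' _ hne
    exact (gcell_disj hne).mono Set.inter_subset_left Set.inter_subset_left
  have hsub : (⋃ j ∈ J, gcell s j ∩ Ω) ⊆ Ω := by
    simp only [Set.iUnion_subset_iff]; intro j _; exact Set.inter_subset_right
  have hi : ∀ {f : Euc d → ℝ}, Continuous f → IntegrableOn f Ω := fun hf => smooth_intOn hb hf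
  calc ∫ x in L, u x ^ 2 ≤ ∫ x in ⋃ j ∈ J, gcell s j ∩ Ω, u x ^ 2 := by
        apply setIntegral_mono_set
        · exact (hi (by fun_prop)).mono_set hsub
        · exact Eventually.of_forall fun t => by positivity
        · apply LE.le.eventuallyLE
          intro x hx
          obtain ⟨j, hj, hxj⟩ := hJ x hx
          simp only [Set.mem_iUnion]
          exact ⟨j, hj, hxj, hL hx⟩
    _ = ∑ j ∈ J, ∫ x in gcell s j ∩ Ω, u x ^ 2 := by
        apply integral_biUnion_finset _ (fun j _ => hm j) hdj
        intro j _
        exact (hi (by fun_prop)).mono_set Set.inter_subset_right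
    _ ≤ ∑ j ∈ J, 2 ^ d * (s * √d) ^ 2 * ∫ x in gcell s j ∩ Ω, ‖fderiv ℝ u x‖ ^ 2 := by
        apply Finset.sum_le_sum
        intro j hj
        exact poincare _ ((gcell_convex hs j).inter hc) (hm j) _ (hb.subset Set.inter_subset_right)
          (fun x hx y hy => gcell_norm hs j x y hx.1 hy.1) u hu (h0 j hj)
    _ = 2 ^ d * d * s ^ 2 * ∫ x in ⋃ j ∈ J, gcell s j ∩ Ω, ‖fderiv ℝ u x‖ ^ 2 := by
        rw [← Finset.mul_sum, mul_pow, Real.sq_sqrt (by positivity)]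
        rw [integral_biUnion_finset _ (fun j _ => hm j) hdj]
        · ring
        · intro j _
          exact (hi (cont_g hu)).mono_set Set.inter_subset_right
    _ ≤ _ := by
        refine mul_le_mul_of_nonneg_left ?_ (by positivity)
        apply setIntegral_mono_set
        · exact hi (cont_g hu)
        · exact Eventually.of_forall fun t => by positivity
        · exact LE.le.eventuallyLE hsub

lemma cell_count {d : ℕ} {s κ : ℝ} (hs : 0 < s) (hκ : 0 ≤ κ) (L U : Set (Euc d))
    (hU : volume U ≤ ENNReal.ofReal κ)
    (hLU : ∀ x ∈ L, ∀ y, ‖y - x‖ ≤ s * √d → y ∈ U) :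
    ∃ J : Finset (Fin d → ℤ), (∀ x ∈ L, ∃ j ∈ J, x ∈ gcell s j) ∧ J.card * s ^ d ≤ κ := by
  set S : Set (Fin d → ℤ) := {j | (gcell s j ∩ L).Nonempty} with hS
  have hsubU : ∀ j ∈ S, gcell s j ⊆ U := by
    rintro j ⟨x, hx, hxL⟩ y hy
    exact hLU x hxL y (gcell_norm hs j x y hx hy)
  have hcard : ∀ J : Finset (Fin d → ℤ), (J : Set _) ⊆ S → J.card * s ^ d ≤ κ := by
    intro J hJ
    have h1 : volume (⋃ j ∈ J, gcell s j : Set (Euc d)) = J.card * ENNReal.ofReal (s ^ d) := by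
      rw [measure_biUnion_finset (fun j _ j' _ h => gcell_disj h) (fun j _ => gcell_meas hs j)]
      simp [gcell_vol hs]
    have h2 : volume (⋃ j ∈ J, gcell s j : Set (Euc d)) ≤ ENNReal.ofReal κ := by
      refine (measure_mono ?_).trans hU
      simp only [Set.iUnion_subset_iff]
      exact fun j hj => hsubU j (hJ hj)
    rw [h1, ← ENNReal.ofReal_natCast, ← ENNReal.ofReal_mul (by positivity),
      ENNReal.ofReal_le_ofReal_iff hκ] at h2
    exact h2
  have hfin : S.Finite := by
    by_contra hinf
    obtain ⟨n, hn⟩ := exists_nat_gt (κ / s ^ d)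
    obtain ⟨J, hJ, hJc⟩ := (Set.not_finite.1 hinf : S.Infinite).exists_subset_card_eq n
    have := hcard J hJ
    rw [div_lt_iff₀ (by positivity)] at hn
    rw [hJc] at this
    linarith
  refine ⟨hfin.toFinset, fun x hx => ⟨fun i => ⌊x i / s⌋, ?_, fun i => rfl⟩, hcard _ (by simp)⟩
  simp only [Set.Finite.mem_toFinset]
  exact ⟨x, fun i => rfl, hx⟩

lemma exists_layer {d : ℕ} (Ω : Set (Euc d)) (hc : Convex ℝ Ω) (ho : IsOpen Ω)
    (hb : Bornology.IsBounded Ω) (κ : ℝ) (hκ : 0 < κ) :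
    ∃ χ : Euc d → ℝ, ContDiff ℝ (⊤ : ℕ∞) χ ∧ (∀ x, 0 ≤ χ x ∧ χ x ≤ 1) ∧ HasCompactSupport χ ∧
      tsupport χ ⊆ Ω ∧ ∃ L ⊆ Ω, MeasurableSet L ∧ (∀ x ∈ Ω, x ∉ L → χ x = 1) ∧
      ∃ s0 > 0, ∀ s, 0 < s → s ≤ s0 → ∃ J : Finset (Fin d → ℤ),
        (∀ x ∈ L, ∃ j ∈ J, x ∈ gcell s j) ∧ J.card * s ^ d ≤ κ := by
  have hf0 : volume (frontier Ω) = 0 := hc.addHaar_frontier volume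
  have hfc : IsCompact (frontier Ω) :=
    hb.isCompact_closure.of_isClosed_subset isClosed_frontier frontier_subset_closure
  obtain ⟨U, hUf, hUo, hUv⟩ := (frontier Ω).exists_isOpen_lt_of_lt (μ := volume)
    (ENNReal.ofReal κ) (by rw [hf0]; simpa using hκ)
  obtain ⟨δ, hδ, hδU⟩ := hfc.exists_thickening_subset_open hUo hUf
  set L := Ω ∩ Metric.thickening (δ / 2) (frontier Ω) with hLdef
  set K := closure Ω \ Metric.thickening (δ / 2) (frontier Ω) with hK
  have hKc : IsCompact K := hb.isCompact_closure.diff Metric.isOpen_thickening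
  have hKΩ : K ⊆ Ω := by
    rintro x ⟨hx, hx2⟩
    by_contra hxn
    apply hx2
    apply Metric.self_subset_thickening (by positivity)
    exact ⟨hx, by rwa [ho.interior_eq]⟩
  obtain ⟨K2, hK2c, hKK2, hK2Ω⟩ := exists_compact_between hKc ho hKΩ
  obtain ⟨χ, hχs, hχr, hχ0, hχ1⟩ := exists_contMDiff_support_eq_eq_one_iff
    (modelWithCornersSelf ℝ (Euc d)) (n := (⊤ : ℕ∞)) (isOpen_interior (s := K2)) hKc.isClosed hKK2
  have hts : tsupport χ ⊆ K2 := by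
    rw [tsupport, hχ0]
    exact closure_minimal interior_subset hK2c.isClosed
  refine ⟨χ, hχs.contDiff, fun x => hχr ⟨x, rfl⟩, ?_, hts.trans hK2Ω, L,
    Set.inter_subset_left, ho.measurableSet.inter Metric.isOpen_thickening.measurableSet, ?_, ?_⟩
  · exact HasCompactSupport.of_support_subset_isCompact hK2c ((subset_tsupport _).trans hts)
  · intro x hx hxL
    rw [← hχ1]
    exact ⟨subset_closure hx, fun h => hxL ⟨hx, h⟩⟩
  · refine ⟨δ / 2 / (√d + 1), by positivity, fun s hs hs0 => ?_⟩
    apply cell_count hs hκ.le L U hUv.le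
    intro x hx y hxy
    apply hδU
    rw [Metric.mem_thickening_iff]
    obtain ⟨z, hz, hxz⟩ := Metric.mem_thickening_iff.1 hx.2
    refine ⟨z, hz, ?_⟩
    rw [le_div_iff₀ (by positivity)] at hs0
    have : dist y x ≤ s * √d := by rwa [dist_eq_norm]
    calc dist y z ≤ dist y x + dist x z := dist_triangle _ _ _
      _ < δ := by nlinarith

/-- Functions with disjoint supports -/
lemma disj_sum {d : ℕ} {ι : Type} [Fintype ι] (f : ι → Euc d → ℝ)
    (hf : ∀ i, ContDiff ℝ (⊤ : ℕ∞) (f i))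
    (hd : Pairwise (fun i j => Disjoint (tsupport (f i)) (tsupport (f j)))) (x : Euc d) :
    (∑ i, f i x) ^ 2 = ∑ i, f i x ^ 2 ∧
    ‖fderiv ℝ (fun y => ∑ i, f i y) x‖ ^ 2 = ∑ i, ‖fderiv ℝ (f i) x‖ ^ 2 := by
  classical
  have hfd : fderiv ℝ (fun y => ∑ i, f i y) x = ∑ i, fderiv ℝ (f i) x := by
    apply fderiv_fun_sum
    intro i _
    exact (hf i).differentiable (by simp) x
  rw [hfd]
  have hz : ∀ i, x ∉ tsupport (f i) → f i x = 0 ∧ fderiv ℝ (f i) x = 0 := by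
    intro i hi
    exact ⟨image_eq_zero_of_notMem_tsupport hi, image_eq_zero_of_notMem_tsupport
      (fun h => hi (tsupport_fderiv_subset ℝ h))⟩
  by_cases h : ∃ i, x ∈ tsupport (f i)
  · obtain ⟨i, hi⟩ := h
    have hj : ∀ j, j ≠ i → f j x = 0 ∧ fderiv ℝ (f j) x = 0 := fun j hji =>
      hz j fun hj => (Set.disjoint_left.1 (hd hji)) hj hi
    rw [Fintype.sum_eq_single i (fun j h => (hj j h).1), Fintype.sum_eq_single i (fun j h => (hj j h).2),
      Fintype.sum_eq_single i (fun j h => by simp [(hj j h).1]),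
      Fintype.sum_eq_single i (fun j h => by simp [(hj j h).2])]
    exact ⟨rfl, rfl⟩
  · push Not at h
    simp [fun i => (hz i (h i)).1, fun i => (hz i (h i)).2]

lemma ev_nonneg {d : ℕ} (Ω : Set (Euc d)) (u : Euc d → ℝ) : 0 ≤ rayleigh Ω u :=
  div_nonneg (integral_nonneg fun x => by positivity) (integral_nonneg fun x => by positivity)

/-- Upper bound for the eigenvalue by a test space. -/
lemma ev_upper {d : ℕ} (k : ℕ) (Ω : Set (Euc d)) (hm : MeasurableSet Ω) {E : Type} [AddCommGroup E] [Module ℝ E]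
    [FiniteDimensional ℝ E] (hE : k + 1 ≤ Module.finrank ℝ E) (T : E →ₗ[ℝ] (Euc d → ℝ))
    (hT : ∀ e, ContDiff ℝ (⊤ : ℕ∞) (T e)) (hpos : ∀ e, e ≠ 0 → 0 < ∫ x in Ω, (T e x) ^ 2)
    (B : ℝ) (hB0 : 0 ≤ B)
    (hB : ∀ e, ∫ x in Ω, ‖fderiv ℝ (T e) x‖ ^ 2 ≤ B * ∫ x in Ω, (T e x) ^ 2) :
    ∃ t ≤ B, ∃ V : Submodule ℝ (Euc d → ℝ),
    (∀ u ∈ V, ContDiff ℝ (⊤ : ℕ∞) u) ∧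
    Module.finrank ℝ (V.map (LinearMap.funLeft ℝ ℝ ((↑) : Ω → Euc d))) = k + 1 ∧
    t = sSup { r : ℝ | ∃ u ∈ V, (0 < ∫ x in Ω, (u x) ^ 2) ∧ r = rayleigh Ω u } := by
  obtain ⟨E', hE'⟩ : ∃ E' : Submodule ℝ E, Module.finrank ℝ E' = k + 1 := by
    obtain ⟨f, hf⟩ := exists_linearIndependent_of_le_finrank (R := ℝ) (M := E) hE
    exact ⟨Submodule.span ℝ (Set.range f), by rw [finrank_span_eq_card hf]; simp⟩
  refine ⟨_, ?_, E'.map T, ?_, ?_, rfl⟩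
  · apply Real.sSup_le _ hB0
    rintro r ⟨u, ⟨e, he, rfl⟩, hu, rfl⟩
    rw [rayleigh, div_le_iff₀ hu]
    exact hB e
  · rintro u ⟨e, he, rfl⟩
    exact hT e
  · rw [← Submodule.map_comp, ← hE']
    refine (LinearEquiv.finrank_eq (Submodule.equivMapOfInjective _ ?_ E')).symm
    rw [injective_iff_map_eq_zero]
    intro e he
    by_contra hne
    have h1 := hpos e hne
    have h2 : ∀ x ∈ Ω, T e x = 0 := fun x hx => congrFun he ⟨x, hx⟩
    have h3 : ∫ x in Ω, (T e x) ^ 2 = 0 := by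
      rw [← integral_zero (Euc d) ℝ (μ := volume.restrict Ω)]
      exact setIntegral_congr_fun hm fun x hx => by simp [h2 x hx]
    linarith

lemma ev_le {d : ℕ} (k : ℕ) (Ω : Set (Euc d)) {B : ℝ} (h : ∃ t ≤ B, ∃ V : Submodule ℝ (Euc d → ℝ),
    (∀ u ∈ V, ContDiff ℝ (⊤ : ℕ∞) u) ∧
    Module.finrank ℝ (V.map (LinearMap.funLeft ℝ ℝ ((↑) : Ω → Euc d))) = k + 1 ∧
    t = sSup { r : ℝ | ∃ u ∈ V, (0 < ∫ x in Ω, (u x) ^ 2) ∧ r = rayleigh Ω u }) :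
    neumannEigenvalue k Ω ≤ B := by
  obtain ⟨t, htB, ht⟩ := h
  rw [neumannEigenvalue]
  refine le_trans (csInf_le ⟨0, ?_⟩ (Set.mem_ofPred_eq.symm ▸ ht)) htB
  rintro t ⟨V, -, -, rfl⟩
  apply Real.sSup_nonneg
  rintro r ⟨u, -, -, rfl⟩
  exact ev_nonneg _ _

lemma pos_int {d : ℕ} {Ω : Set (Euc d)} (ho : IsOpen Ω) (hb : Bornology.IsBounded Ω)
    {u : Euc d → ℝ} (hu : Continuous u) {x : Euc d} (hx : x ∈ Ω) (hux : u x ≠ 0) :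
    0 < ∫ x in Ω, u x ^ 2 := by
  rw [setIntegral_pos_iff_support_of_nonneg_ae]
  · apply IsOpen.measure_pos
    · exact ((isOpen_ne_fun (hu.pow 2) continuous_const)).inter ho
    · exact ⟨x, by simpa using hux, hx⟩
  · exact Eventually.of_forall fun t => by positivity
  · exact smooth_intOn hb (by fun_prop)

lemma fderiv_congr_open {d : ℕ} {Ω : Set (Euc d)} (ho : IsOpen Ω) {u v : Euc d → ℝ}
    (h : ∀ x ∈ Ω, u x = v x) {x : Euc d} (hx : x ∈ Ω) : fderiv ℝ u x = fderiv ℝ v x := by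
  apply Filter.EventuallyEq.fderiv_eq
  filter_upwards [ho.mem_nhds hx] with y hy using h y hy

lemma fin_bound {d n : ℕ} {Ω : Set (Euc d)} (hb : Bornology.IsBounded Ω)
    (u : Fin n → Euc d → ℝ) (hu : ∀ i, ContDiff ℝ (⊤ : ℕ∞) (u i))
    (hpos : ∀ c : Fin n → ℝ, c ≠ 0 → 0 < ∫ x in Ω, (∑ i, c i * u i x) ^ 2) :
    ∃ M : ℝ, ∀ c : Fin n → ℝ, ∫ x in Ω, ‖fderiv ℝ (fun x => ∑ i, c i * u i x) x‖ ^ 2 ≤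
      M * ∫ x in Ω, (∑ i, c i * u i x) ^ 2 := by
  have hcu : ∀ i, Continuous (u i) := fun i => (hu i).continuous
  have hcg : ∀ i, Continuous (fun x => ‖fderiv ℝ (u i) x‖) :=
    fun i => ((hu i).continuous_fderiv (by simp)).norm
  set A := ∫ x in Ω, (∑ i, ‖fderiv ℝ (u i) x‖) ^ 2 with hA
  have hA0 : 0 ≤ A := integral_nonneg fun x => by positivity
  have hG : ∀ c : Fin n → ℝ, ∫ x in Ω, ‖fderiv ℝ (fun x => ∑ i, c i * u i x) x‖ ^ 2 ≤ ‖c‖ ^ 2 * A := by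
    intro c
    rw [hA, ← integral_const_mul]
    have hsm : ContDiff ℝ (⊤ : ℕ∞) (fun x => ∑ i, c i * u i x) :=
      ContDiff.sum fun i _ => contDiff_const.mul (hu i)
    apply setIntegral_mono (smooth_intOn hb (cont_g hsm)) (smooth_intOn hb (by fun_prop))
    intro x
    simp only
    rw [← mul_pow, Finset.mul_sum]
    gcongr
    rw [fderiv_fun_sum (fun i _ => ((hu i).differentiable (by simp) x).const_mul _)]
    refine (norm_sum_le _ _).trans (Finset.sum_le_sum fun i _ => ?_)
    rw [fderiv_const_mul ((hu i).differentiable (by simp) x), norm_smul]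
    gcongr
    exact norm_le_pi_norm c i
  have hNc : Continuous (fun c : Fin n → ℝ => ∫ x in Ω, (∑ i, c i * u i x) ^ 2) := by
    have : ∀ c : Fin n → ℝ, ∫ x in Ω, (∑ i, c i * u i x) ^ 2 =
        ∑ i, ∑ j, c i * c j * ∫ x in Ω, u i x * u j x := by
      intro c
      have e : ∀ x, (∑ i, c i * u i x) ^ 2 = ∑ i, ∑ j, c i * c j * (u i x * u j x) := by
        intro x
        rw [sq, Finset.sum_mul_sum]
        refine Finset.sum_congr rfl fun i _ => Finset.sum_congr rfl fun j _ => by ring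
      simp_rw [e]
      rw [integral_finsetSum _ fun i _ => smooth_intOn hb (by fun_prop)]
      refine Finset.sum_congr rfl fun i _ => ?_
      rw [integral_finsetSum _ fun i _ => smooth_intOn hb (by fun_prop)]
      refine Finset.sum_congr rfl fun j _ => ?_
      rw [integral_const_mul]
    simp_rw [this]
    fun_prop
  rcases (Metric.sphere (0 : Fin n → ℝ) 1).eq_empty_or_nonempty with hemp | hne
  · refine ⟨0, fun c => ?_⟩
    have hc : c = 0 := by
      by_contra hc
      have : ‖c‖⁻¹ • c ∈ Metric.sphere (0 : Fin n → ℝ) 1 := by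
        simp [norm_smul, inv_mul_cancel₀ (norm_ne_zero_iff.2 hc)]
      rw [hemp] at this; exact this
    refine (hG c).trans ?_
    simp [hc]
  · obtain ⟨c0, hc0, hmin⟩ := (isCompact_sphere (0 : Fin n → ℝ) 1).exists_isMinOn hne hNc.continuousOn
    set m := ∫ x in Ω, (∑ i, c0 i * u i x) ^ 2 with hm
    have hm0 : 0 < m := hpos c0 (by rintro rfl; simp at hc0)
    refine ⟨A / m, fun c => ?_⟩
    by_cases hc : c = 0
    · refine (hG c).trans ?_
      simp [hc]
    have hn : ‖c‖ ≠ 0 := norm_ne_zero_iff.2 hc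
    have h1 : m ≤ ∫ x in Ω, (∑ i, (‖c‖⁻¹ • c) i * u i x) ^ 2 :=
      hmin (by simp [norm_smul, inv_mul_cancel₀ hn] : ‖c‖⁻¹ • c ∈ Metric.sphere (0 : Fin n → ℝ) 1)
    have h2 : ∫ x in Ω, (∑ i, (‖c‖⁻¹ • c) i * u i x) ^ 2 =
        (‖c‖⁻¹) ^ 2 * ∫ x in Ω, (∑ i, c i * u i x) ^ 2 := by
      rw [← integral_const_mul]
      congr 1; ext x
      rw [← mul_pow, Finset.mul_sum]
      simp [mul_assoc]
    rw [h2] at h1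
    refine (hG c).trans ?_
    have h3 : ‖c‖ ^ 2 * m ≤ ∫ x in Ω, (∑ i, c i * u i x) ^ 2 := by
      calc ‖c‖ ^ 2 * m ≤ ‖c‖ ^ 2 * ((‖c‖⁻¹) ^ 2 * ∫ x in Ω, (∑ i, c i * u i x) ^ 2) := by gcongr
        _ = _ := by field_simp
    calc ‖c‖ ^ 2 * A = A / m * (‖c‖ ^ 2 * m) := by field_simp
      _ ≤ _ := by gcongr

lemma ev_lower {d : ℕ} (k : ℕ) {Ω : Set (Euc d)} (ho : IsOpen Ω) (hb : Bornology.IsBounded Ω)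
    (V : Submodule ℝ (Euc d → ℝ)) (hV : ∀ u ∈ V, ContDiff ℝ (⊤ : ℕ∞) u)
    (hr : Module.finrank ℝ (V.map (LinearMap.funLeft ℝ ℝ ((↑) : Ω → Euc d))) = k + 1) :
    ∃ S : (Fin (k + 1) → ℝ) →ₗ[ℝ] (Euc d → ℝ), (∀ c, ContDiff ℝ (⊤ : ℕ∞) (S c)) ∧
      (∀ c, c ≠ 0 → 0 < ∫ x in Ω, (S c x) ^ 2) ∧
      ∀ c, ∫ x in Ω, ‖fderiv ℝ (S c) x‖ ^ 2 ≤
        sSup { r : ℝ | ∃ u ∈ V, (0 < ∫ x in Ω, (u x) ^ 2) ∧ r = rayleigh Ω u } *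
          ∫ x in Ω, (S c x) ^ 2 := by
  set R := LinearMap.funLeft ℝ ℝ ((↑) : Ω → Euc d) with hR
  have hfd : FiniteDimensional ℝ (V.map R) := Module.finite_of_finrank_pos (by omega)
  let b := Module.finBasisOfFinrankEq ℝ (V.map R) hr
  have hex : ∀ i, ∃ u ∈ V, R u = b i := fun i => (b i).2
  choose u huV hub using hex
  have hu : ∀ i, ContDiff ℝ (⊤ : ℕ∞) (u i) := fun i => hV _ (huV i)
  let S : (Fin (k + 1) → ℝ) →ₗ[ℝ] (Euc d → ℝ) := Fintype.linearCombination ℝ u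
  have hS : ∀ c, S c = fun x => ∑ i, c i * u i x := by
    intro c; ext x
    simp [S, Fintype.linearCombination_apply, Finset.sum_apply]
  have hSV : ∀ c, S c ∈ V := by
    intro c
    simp only [S, Fintype.linearCombination_apply]
    exact V.sum_mem fun i _ => V.smul_mem _ (huV i)
  have hRS : ∀ c, R (S c) = (b.equivFun.symm c : V.map R) := by
    intro c
    simp [S, Fintype.linearCombination_apply, Module.Basis.equivFun_symm_apply, hub]
  have hpos : ∀ c, c ≠ 0 → 0 < ∫ x in Ω, (S c x) ^ 2 := by
    intro c hc
    by_cases h : ∃ x ∈ Ω, S c x ≠ 0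
    · obtain ⟨x, hx, hne⟩ := h
      exact pos_int ho hb (hV _ (hSV c)).continuous hx hne
    · push Not at h
      exfalso
      apply hc
      have : R (S c) = 0 := by ext ⟨x, hx⟩; exact h x hx
      rw [hRS] at this
      exact (LinearEquiv.map_eq_zero_iff _).1 ((Submodule.coe_eq_zero).1 this)
  refine ⟨S, fun c => hV _ (hSV c), hpos, ?_⟩
  obtain ⟨M, hM⟩ := fin_bound hb u hu (by simpa only [hS] using hpos)
  have hbdd : BddAbove { r : ℝ | ∃ u ∈ V, (0 < ∫ x in Ω, (u x) ^ 2) ∧ r = rayleigh Ω u } := by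
    refine ⟨M, ?_⟩
    rintro r ⟨v, hv, hvp, rfl⟩
    obtain ⟨c, hc⟩ : ∃ c, R (S c) = R v := by
      refine ⟨b.equivFun ⟨R v, Submodule.mem_map_of_mem hv⟩, ?_⟩
      rw [hRS]; simp
    have hc' : ∀ x ∈ Ω, v x = S c x := fun x hx => (congrFun hc ⟨x, hx⟩).symm
    have e1 : ∫ x in Ω, (v x) ^ 2 = ∫ x in Ω, (S c x) ^ 2 :=
      setIntegral_congr_fun ho.measurableSet fun x hx => by simp [hc' x hx]
    have e2 : ∫ x in Ω, ‖fderiv ℝ v x‖ ^ 2 = ∫ x in Ω, ‖fderiv ℝ (S c) x‖ ^ 2 :=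
      setIntegral_congr_fun ho.measurableSet fun x hx => by simp [fderiv_congr_open ho hc' hx]
    rw [rayleigh, div_le_iff₀ hvp, e1, e2, hS]
    exact hM c
  intro c
  by_cases hc : c = 0
  · subst hc
    simp
  · rw [← div_le_iff₀ (hpos c hc)]
    exact le_csSup hbdd ⟨S c, hSV c, hpos c hc, rfl⟩

lemma constraints {d k : ℕ} {Ω : Set (Euc d)} (hb : Bornology.IsBounded Ω)
    (S : (Fin (k + 1) → ℝ) →ₗ[ℝ] (Euc d → ℝ)) (hS : ∀ c, ContDiff ℝ (⊤ : ℕ∞) (S c))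
    (s : ℝ) (J : Finset (Fin d → ℤ)) :
    ∃ E1 : Submodule ℝ (Fin (k + 1) → ℝ), k + 1 ≤ Module.finrank ℝ E1 + J.card ∧
      ∀ c ∈ E1, ∀ j ∈ J, ∫ x in gcell s j ∩ Ω, S c x = 0 := by
  have hi : ∀ c j, IntegrableOn (S c) (gcell s j ∩ Ω) := fun c j =>
    smooth_intOn (hb.subset Set.inter_subset_right) (hS c).continuous
  let A : (Fin (k + 1) → ℝ) →ₗ[ℝ] (J → ℝ) :=
    { toFun := fun c j => ∫ x in gcell s j.1 ∩ Ω, S c x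
      map_add' := by
        intro c c'
        ext j
        simp only [map_add, Pi.add_apply]
        exact integral_add (hi c j) (hi c' j)
      map_smul' := by
        intro a c
        ext j
        simp only [map_smul, Pi.smul_apply, smul_eq_mul, RingHom.id_apply]
        exact integral_const_mul _ _ }
  refine ⟨LinearMap.ker A, ?_, fun c hc j hj => congrFun (LinearMap.mem_ker.1 hc) ⟨j, hj⟩⟩
  have h1 := LinearMap.finrank_range_add_finrank_ker A
  have h2 := Submodule.finrank_le (LinearMap.range A)
  simp only [Module.finrank_fintype_fun_eq_card, Fintype.card_coe, Fintype.card_fin] at h1 h2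
  omega

lemma lam_large {d : ℕ} {Ω : Set (Euc d)} (hc : Convex ℝ Ω) (ho : IsOpen Ω)
    (hb : Bornology.IsBounded Ω) (M : ℝ) : ∃ K : ℕ, ∀ k ≥ K,
    ∀ S : (Fin (k + 1) → ℝ) →ₗ[ℝ] (Euc d → ℝ), (∀ c, ContDiff ℝ (⊤ : ℕ∞) (S c)) →
      (∀ c, c ≠ 0 → 0 < ∫ x in Ω, (S c x) ^ 2) →
      ∀ Λ : ℝ, (∀ c, ∫ x in Ω, ‖fderiv ℝ (S c) x‖ ^ 2 ≤ Λ * ∫ x in Ω, (S c x) ^ 2) → M < Λ := by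
  set c0 : ℝ := 2 ^ d * d with hc0
  have hc0' : 0 ≤ c0 := by positivity
  set s : ℝ := 1 / √(c0 * |M| + 1) with hs
  have hspos : 0 < s := by positivity
  have hs2 : s ^ 2 = 1 / (c0 * |M| + 1) := by
    rw [hs, div_pow, Real.sq_sqrt (by positivity), one_pow]
  obtain ⟨R, hR⟩ := hb.subset_ball (0 : Euc d)
  set U := Metric.ball (0 : Euc d) (R + s * √d) with hU
  have hUt : volume U ≠ ⊤ := measure_ball_lt_top.ne
  obtain ⟨J, hJ, -⟩ := cell_count (κ := (volume U).toReal) hspos ENNReal.toReal_nonneg Ω U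
    (by rw [ENNReal.ofReal_toReal hUt]) (by
      intro x hx y hxy
      have := hR hx
      rw [mem_ball_zero_iff] at this ⊢
      calc ‖y‖ = ‖x + (y - x)‖ := by simp
        _ ≤ ‖x‖ + ‖y - x‖ := norm_add_le _ _
        _ < _ := by linarith)
  refine ⟨J.card, fun k hk S hS hpos Λ hΛ => ?_⟩
  obtain ⟨E1, hE1, hE0⟩ := constraints hb S hS s J
  have : 0 < Module.finrank ℝ E1 := by omega
  obtain ⟨⟨c, hcE⟩, hcne⟩ := (Module.finrank_pos_iff_exists_ne_zero (R := ℝ)).1 this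
  have hcne' : c ≠ 0 := fun h => hcne (by ext1; exact h)
  have h1 := layer_poincare Ω hc ho hb hspos Ω subset_rfl J hJ (S c) (hS c) (hE0 c hcE)
  have h2 := hpos c hcne'
  have h3 := hΛ c
  by_contra hcon
  push Not at hcon
  rw [← hc0, hs2] at h1
  set N := ∫ x in Ω, (S c x) ^ 2
  set G := ∫ x in Ω, ‖fderiv ℝ (S c) x‖ ^ 2
  have h4 : G ≤ |M| * N := h3.trans (by gcongr; exact hcon.trans (le_abs_self _))
  have h5 : c0 * (1 / (c0 * |M| + 1)) * G ≤ c0 * (1 / (c0 * |M| + 1)) * (|M| * N) := by gcongr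
  have h6 : c0 * (1 / (c0 * |M| + 1)) * (|M| * N) = (c0 * |M|) / (c0 * |M| + 1) * N := by ring
  have h7 : (c0 * |M|) / (c0 * |M| + 1) < 1 := by rw [div_lt_one (by positivity)]; linarith
  have h8 : (c0 * |M|) / (c0 * |M| + 1) * N < 1 * N := by gcongr
  linarith

lemma scale_int {d : ℕ} (F : Euc d → ℝ) {t : ℝ} (ht : 0 < t) (v : Euc d) :
    ∫ x, F (t • x + v) = (t ^ d)⁻¹ * ∫ x, F x := by
  have := Measure.integral_comp_smul (volume : Measure (Euc d)) (fun x => F (x + v)) t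
  rw [this, integral_add_right_eq_self (fun x => F x), abs_of_pos (by positivity)]
  simp

lemma scale_fderiv {d : ℕ} {f : Euc d → ℝ} (hf : ContDiff ℝ (⊤ : ℕ∞) f) {t : ℝ} (v x : Euc d) :
    ‖fderiv ℝ (fun x => f (t • x + v)) x‖ ^ 2 = t ^ 2 * ‖fderiv ℝ f (t • x + v)‖ ^ 2 := by
  have h1 : HasFDerivAt (fun x : Euc d => t • x + v) (t • ContinuousLinearMap.id ℝ (Euc d)) x :=
    ((hasFDerivAt_id x).const_smul t).add_const v
  have h2 := ((hf.differentiable (by simp) (t • x + v)).hasFDerivAt).comp x h1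
  have h3 : fderiv ℝ (fun x => f (t • x + v)) x = t • fderiv ℝ f (t • x + v) := by
    have := h2.fderiv
    simp only [Function.comp_def] at this
    rw [this]; ext y; simp
  rw [h3, norm_smul, mul_pow]; simp

lemma scale_smooth {d : ℕ} {f : Euc d → ℝ} (hf : ContDiff ℝ (⊤ : ℕ∞) f) (t : ℝ) (v : Euc d) :
    ContDiff ℝ (⊤ : ℕ∞) (fun x => f (t • x + v)) :=
  hf.comp ((contDiff_id.const_smul t).add contDiff_const)

lemma scale_tsupport {d : ℕ} (f : Euc d → ℝ) (t : ℝ) (v : Euc d) :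
    tsupport (fun x => f (t • x + v)) ⊆ (fun x => t • x + v) ⁻¹' tsupport f := by
  apply closure_minimal
  · intro x hx
    exact subset_tsupport _ hx
  · exact (isClosed_tsupport f).preimage (by fun_prop)

lemma bumps (d : ℕ) : ∃ R0 : ℝ, 0 < R0 ∧ ∀ (p : Euc d) (ρ : ℝ), 0 < ρ → ∃ a : ℝ, 0 < a ∧ ∀ l : ℝ, 0 < l → l ≤ a →
    ∃ n : ℕ, a / l ≤ n ∧ ∃ b : (Fin d → Fin n) → Euc d → ℝ,
      (∀ j, ContDiff ℝ (⊤ : ℕ∞) (b j)) ∧ (∀ j, tsupport (b j) ⊆ Metric.ball p ρ) ∧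
      (Pairwise (fun i j => Disjoint (tsupport (b i)) (tsupport (b j)))) ∧
      (∀ j, 0 < ∫ x, b j x ^ 2) ∧
      ∀ j, ∫ x, ‖fderiv ℝ (b j) x‖ ^ 2 ≤ R0 / l ^ 2 * ∫ x, b j x ^ 2 := by
  let β : ContDiffBump (0 : Euc d) := ⟨1 / 8, 1 / 4, by norm_num, by norm_num⟩
  have hβ : ContDiff ℝ (⊤ : ℕ∞) (β : Euc d → ℝ) := β.contDiff
  have hβt : tsupport (β : Euc d → ℝ) = Metric.closedBall 0 (1 / 4) := β.tsupport_eq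
  have hN : 0 < ∫ x, β x ^ 2 := by
    have h := pos_int (Metric.isOpen_ball (x := (0 : Euc d)) (ε := 1)) Metric.isBounded_ball
      hβ.continuous (x := 0) (by simp) (by
        rw [β.one_of_mem_closedBall (by simp [β.rIn_pos.le])]; norm_num)
    refine h.trans_le (setIntegral_le_integral ?_ (Eventually.of_forall fun t => by positivity))
    apply Continuous.integrable_of_hasCompactSupport (by fun_prop)
    have e : (fun x => β x ^ 2) = (β : Euc d → ℝ) * β := by ext x; simp [sq]
    rw [e]
    exact β.hasCompactSupport.mul_right
  set N := ∫ x, β x ^ 2 with hNd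
  set G := ∫ x, ‖fderiv ℝ β x‖ ^ 2 with hGd
  have hG0 : 0 ≤ G := integral_nonneg fun x => by positivity
  refine ⟨G / N + 1, by positivity, fun p ρ hρ => ⟨ρ / (2 * √d + 2), by positivity,
    fun l hl hla => ?_⟩⟩
  set a := ρ / (2 * √d + 2) with ha
  have ha0 : 0 < a := by positivity
  have haρ : a * (2 * √d + 2) = ρ := by rw [ha]; field_simp
  let w : (Fin d → Fin ⌈a / l⌉₊) → Euc d := fun j => WithLp.toLp 2 fun i => ((j i : ℕ) : ℝ)
  have hn2 : (⌈a / l⌉₊ : ℝ) ≤ 2 * (a / l) := by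
    have h1 := (Nat.ceil_lt_add_one (show 0 ≤ a / l by positivity)).le
    have h2 : 1 ≤ a / l := by rwa [le_div_iff₀ hl, one_mul]
    linarith
  have hw : ∀ j, ‖w j‖ ≤ 2 * (a / l) * √d := by
    intro j
    rw [EuclideanSpace.norm_eq]
    have : ∑ i, ‖w j i‖ ^ 2 ≤ (2 * (a / l)) ^ 2 * d := by
      calc ∑ i, ‖w j i‖ ^ 2 ≤ ∑ i : Fin d, (2 * (a / l)) ^ 2 := by
            apply Finset.sum_le_sum
            intro i _
            have : ‖w j i‖ ≤ 2 * (a / l) := by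
              simp only [w, Real.norm_eq_abs, Nat.abs_cast]
              exact le_trans (by exact_mod_cast (j i).2.le) hn2
            gcongr
        _ = _ := by simp [mul_comm]
    calc √(∑ i, ‖w j i‖ ^ 2) ≤ √((2 * (a / l)) ^ 2 * d) := Real.sqrt_le_sqrt this
      _ = _ := by rw [Real.sqrt_mul (by positivity), Real.sqrt_sq (by positivity)]
  have hww : ∀ i j, i ≠ j → 1 ≤ ‖w i - w j‖ := by
    intro i j hij
    obtain ⟨m, hm⟩ := Function.ne_iff.1 hij
    refine le_trans ?_ (PiLp.norm_apply_le (w i - w j) m)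
    simp only [w, PiLp.sub_apply, Real.norm_eq_abs]
    have : ((i m : ℕ) : ℤ) - (j m : ℕ) ≠ 0 := by
      intro h; apply hm; ext; omega
    have h1 := Int.one_le_abs this
    exact_mod_cast h1
  let b : (Fin d → Fin ⌈a / l⌉₊) → Euc d → ℝ := fun j x => β (l⁻¹ • x + (-(l⁻¹ • p) - w j))
  have hsup : ∀ j x, x ∈ tsupport (b j) → ‖l⁻¹ • (x - p) - w j‖ ≤ 1 / 4 := by
    intro j x hx
    have := scale_tsupport β l⁻¹ (-(l⁻¹ • p) - w j) hx
    rw [hβt, Set.mem_preimage, mem_closedBall_zero_iff] at this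
    have e : l⁻¹ • (x - p) - w j = l⁻¹ • x + (-(l⁻¹ • p) - w j) := by rw [smul_sub]; abel
    rw [e]
    exact this
  refine ⟨⌈a / l⌉₊, Nat.le_ceil _, b, fun j => scale_smooth hβ _ _, ?_, ?_, ?_, ?_⟩
  · intro j x hx
    have h1 := hsup j x hx
    have h2 : ‖l⁻¹ • (x - p)‖ ≤ 1 / 4 + 2 * (a / l) * √d := by
      calc ‖l⁻¹ • (x - p)‖ = ‖(l⁻¹ • (x - p) - w j) + w j‖ := by simp
        _ ≤ _ := (norm_add_le _ _).trans (add_le_add h1 (hw j))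
    rw [norm_smul, Real.norm_eq_abs, abs_of_pos (by positivity)] at h2
    have h3 : ‖x - p‖ ≤ l / 4 + 2 * a * √d := by
      have h4 : l * (l⁻¹ * ‖x - p‖) ≤ l * (1 / 4 + 2 * (a / l) * √d) := by gcongr
      have e1 : l * (l⁻¹ * ‖x - p‖) = ‖x - p‖ := by field_simp
      have e2 : l * (1 / 4 + 2 * (a / l) * √d) = l / 4 + 2 * a * √d := by field_simp
      rwa [e1, e2] at h4
    rw [Metric.mem_ball, dist_eq_norm]
    nlinarith
  · intro i j hij
    rw [Set.disjoint_left]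
    intro x hx hx'
    have h1 := hsup i x hx
    have h2 := hsup j x hx'
    have h3 := hww i j hij
    have h4 : ‖w i - w j‖ ≤ 1 / 4 + 1 / 4 := by
      calc ‖w i - w j‖ = ‖(l⁻¹ • (x - p) - w j) - (l⁻¹ • (x - p) - w i)‖ := by congr 1; abel
        _ ≤ _ := (norm_sub_le _ _).trans (add_le_add h2 h1)
    linarith
  · intro j
    have := scale_int (fun x => β x ^ 2) (t := l⁻¹) (by positivity) (-(l⁻¹ • p) - w j)
    simp only [b]
    rw [this]
    positivity
  · intro j
    have h1 := scale_int (fun x => β x ^ 2) (t := l⁻¹) (by positivity) (-(l⁻¹ • p) - w j)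
    have h2 := scale_int (fun x => ‖fderiv ℝ β x‖ ^ 2) (t := l⁻¹) (by positivity) (-(l⁻¹ • p) - w j)
    have h3 : ∀ x, ‖fderiv ℝ (b j) x‖ ^ 2 = _ := fun x => scale_fderiv hβ (-(l⁻¹ • p) - w j) x
    simp_rw [h3]
    rw [integral_const_mul, h2]
    simp only [b]
    rw [h1]
    have h4 : G ≤ (G / N + 1) * N := by rw [add_mul, div_mul_cancel₀ _ hN.ne']; linarith
    have h5 : 0 ≤ l⁻¹ ^ 2 * (l⁻¹ ^ d)⁻¹ := by positivity
    calc l⁻¹ ^ 2 * ((l⁻¹ ^ d)⁻¹ * G) = l⁻¹ ^ 2 * (l⁻¹ ^ d)⁻¹ * G := by ring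
      _ ≤ l⁻¹ ^ 2 * (l⁻¹ ^ d)⁻¹ * ((G / N + 1) * N) := by gcongr
      _ = _ := by rw [← hNd]; field_simp

lemma whole_eq {d : ℕ} {Ω : Set (Euc d)} {f : Euc d → ℝ} (h : tsupport f ⊆ Ω) :
    ∫ x in Ω, f x ^ 2 = ∫ x, f x ^ 2 ∧
    ∫ x in Ω, ‖fderiv ℝ f x‖ ^ 2 = ∫ x, ‖fderiv ℝ f x‖ ^ 2 := by
  constructor
  · apply setIntegral_eq_integral_of_forall_compl_eq_zero
    intro x hx
    simp [image_eq_zero_of_notMem_tsupport (fun hh => hx (h hh))]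
  · apply setIntegral_eq_integral_of_forall_compl_eq_zero
    intro x hx
    rw [image_eq_zero_of_notMem_tsupport (f := fderiv ℝ f)
      (fun hh => hx (h (tsupport_fderiv_subset ℝ hh)))]
    simp

lemma int_cs {d : ℕ} {f : Euc d → ℝ} (hf : ContDiff ℝ (⊤ : ℕ∞) f) (hc : HasCompactSupport f) :
    Integrable (fun x => f x ^ 2) ∧ Integrable (fun x => ‖fderiv ℝ f x‖ ^ 2) := by
  have hcf := hf.continuous
  constructor
  · apply Continuous.integrable_of_hasCompactSupport (by fun_prop)
    exact hc.comp_left (g := fun y : ℝ => y ^ 2) (by simp)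
  · apply Continuous.integrable_of_hasCompactSupport (cont_g hf)
    exact (hc.fderiv ℝ).comp_left (g := fun y => ‖y‖ ^ 2) (by simp)

lemma disj_ray {d : ℕ} {Ω : Set (Euc d)} {ι : Type} [Fintype ι] (f : ι → Euc d → ℝ)
    (hf : ∀ i, ContDiff ℝ (⊤ : ℕ∞) (f i)) (hb : Bornology.IsBounded Ω)
    (hd : Pairwise (fun i j => Disjoint (tsupport (f i)) (tsupport (f j))))
    (hs : ∀ i, tsupport (f i) ⊆ Ω) :
    ∫ x in Ω, (∑ i, f i x) ^ 2 = ∑ i, ∫ x, f i x ^ 2 ∧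
    ∫ x in Ω, ‖fderiv ℝ (fun y => ∑ i, f i y) x‖ ^ 2 = ∑ i, ∫ x, ‖fderiv ℝ (f i) x‖ ^ 2 := by
  simp_rw [fun x => (disj_sum f hf hd x).1, fun x => (disj_sum f hf hd x).2]
  have hc : ∀ i, HasCompactSupport (f i) := fun i =>
    (hb.subset (hs i)).isCompact_closure.of_isClosed_subset (isClosed_tsupport _) subset_closure
  constructor
  · rw [integral_finsetSum _ fun i _ => (int_cs (hf i) (hc i)).1.integrableOn]
    exact Finset.sum_congr rfl fun i _ => (whole_eq (hs i)).1
  · rw [integral_finsetSum _ fun i _ => (int_cs (hf i) (hc i)).2.integrableOn]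
    exact Finset.sum_congr rfl fun i _ => (whole_eq (hs i)).2

lemma const_mul_int {d : ℕ} {f : Euc d → ℝ} (hf : ContDiff ℝ (⊤ : ℕ∞) f) (c : ℝ) :
    ∫ x, (c * f x) ^ 2 = c ^ 2 * ∫ x, f x ^ 2 ∧
    ∫ x, ‖fderiv ℝ (fun x => c * f x) x‖ ^ 2 = c ^ 2 * ∫ x, ‖fderiv ℝ f x‖ ^ 2 := by
  constructor
  · rw [← integral_const_mul]; congr 1; ext x; ring
  · rw [← integral_const_mul]; congr 1; ext x
    rw [fderiv_const_mul (hf.differentiable (by simp) x), norm_smul, mul_pow]; simp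

lemma tsupport_cmul {d : ℕ} (f : Euc d → ℝ) (c : ℝ) : tsupport (fun x => c * f x) ⊆ tsupport f := by
  apply closure_mono
  intro x hx h
  apply hx
  simp [h]

lemma cutoff {d : ℕ} {Ω L : Set (Euc d)} (ho : IsOpen Ω) (hb : Bornology.IsBounded Ω)
    (hLm : MeasurableSet L) (hL : L ⊆ Ω) {χ u : Euc d → ℝ} (hχ : ContDiff ℝ (⊤ : ℕ∞) χ)
    (hχ01 : ∀ x, 0 ≤ χ x ∧ χ x ≤ 1) (hχΩ : tsupport χ ⊆ Ω) (hχL : ∀ x ∈ Ω, x ∉ L → χ x = 1)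
    (hu : ContDiff ℝ (⊤ : ℕ∞) u) {η D Λ : ℝ} (hη : 0 < η) (hD : ∀ x, ‖fderiv ℝ χ x‖ ^ 2 ≤ D)
    (hLη : ∫ x in L, u x ^ 2 ≤ η * ∫ x in Ω, u x ^ 2)
    (hΛ : ∫ x in Ω, ‖fderiv ℝ u x‖ ^ 2 ≤ Λ * ∫ x in Ω, u x ^ 2) :
    (1 - η) * (∫ x in Ω, u x ^ 2) ≤ ∫ x, (χ x * u x) ^ 2 ∧
    ∫ x, ‖fderiv ℝ (fun x => χ x * u x) x‖ ^ 2 ≤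
      ((1 + η) * Λ + (1 + 1 / η) * D) * ∫ x in Ω, u x ^ 2 := by
  have hcu := hu.continuous
  have hcχ := hχ.continuous
  have hsm : ContDiff ℝ (⊤ : ℕ∞) (fun x => χ x * u x) := hχ.mul hu
  have hts : tsupport (fun x => χ x * u x) ⊆ Ω := by
    refine subset_trans (closure_mono ?_) hχΩ
    intro x hx h
    apply hx
    simp [h]
  obtain ⟨e1, e2⟩ := whole_eq hts
  rw [← e1, ← e2]
  constructor
  · have h1 : ∫ x in Ω, u x ^ 2 = (∫ x in L, u x ^ 2) + ∫ x in Ω \ L, u x ^ 2 := by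
      rw [← setIntegral_union Set.disjoint_sdiff_right (ho.measurableSet.diff hLm)
        ((smooth_intOn hb (by fun_prop)).mono_set hL)
        ((smooth_intOn hb (by fun_prop)).mono_set Set.sdiff_subset), Set.union_sdiff_cancel hL]
    have h2 : ∫ x in Ω \ L, u x ^ 2 = ∫ x in Ω \ L, (χ x * u x) ^ 2 :=
      setIntegral_congr_fun (ho.measurableSet.diff hLm) fun x hx => by simp [hχL x hx.1 hx.2]
    have h3 : ∫ x in Ω \ L, (χ x * u x) ^ 2 ≤ ∫ x in Ω, (χ x * u x) ^ 2 := by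
      apply setIntegral_mono_set (smooth_intOn hb (by fun_prop))
      · exact Eventually.of_forall fun t => by positivity
      · exact LE.le.eventuallyLE Set.sdiff_subset
    linarith
  · have hN0 : 0 ≤ ∫ x in Ω, u x ^ 2 := integral_nonneg fun x => by positivity
    calc ∫ x in Ω, ‖fderiv ℝ (fun x => χ x * u x) x‖ ^ 2
        ≤ ∫ x in Ω, ((1 + η) * ‖fderiv ℝ u x‖ ^ 2 + (1 + 1 / η) * D * u x ^ 2) := by
          have hcg := cont_g hu
          apply setIntegral_mono (smooth_intOn hb (cont_g hsm)) (smooth_intOn hb (by fun_prop))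
          intro x
          simp only
          rw [fderiv_fun_mul (hχ.differentiable (by simp) x) (hu.differentiable (by simp) x)]
          set A := ‖fderiv ℝ u x‖
          set B := ‖fderiv ℝ χ x‖
          have h1 : ‖χ x • fderiv ℝ u x + u x • fderiv ℝ χ x‖ ≤ A + |u x| * B := by
            refine (norm_add_le _ _).trans ?_
            rw [norm_smul, norm_smul, Real.norm_eq_abs, Real.norm_eq_abs, abs_of_nonneg (hχ01 x).1]
            have : χ x * A ≤ 1 * A := by gcongr; exact (hχ01 x).2
            linarith
          have h2 : (A + |u x| * B) ^ 2 ≤ (1 + η) * A ^ 2 + (1 + 1 / η) * (|u x| * B) ^ 2 := by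
            have h3 : (1 + η) * A ^ 2 + (1 + 1 / η) * (|u x| * B) ^ 2 - (A + |u x| * B) ^ 2 =
              η * (A - (|u x| * B) / η) ^ 2 := by field_simp; ring
            have h4 : 0 ≤ η * (A - (|u x| * B) / η) ^ 2 := by positivity
            linarith
          calc ‖χ x • fderiv ℝ u x + u x • fderiv ℝ χ x‖ ^ 2 ≤ (A + |u x| * B) ^ 2 := by gcongr
            _ ≤ _ := h2
            _ = (1 + η) * A ^ 2 + (1 + 1 / η) * (B ^ 2 * u x ^ 2) := by
                rw [mul_pow, sq_abs]; ring
            _ ≤ (1 + η) * A ^ 2 + (1 + 1 / η) * (D * u x ^ 2) := by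
                gcongr; exact hD x
            _ = _ := by ring
      _ = (1 + η) * (∫ x in Ω, ‖fderiv ℝ u x‖ ^ 2) + (1 + 1 / η) * D * ∫ x in Ω, u x ^ 2 := by
          have hcg := cont_g hu
          rw [integral_add (smooth_intOn hb (by fun_prop)) (smooth_intOn hb (by fun_prop)),
            integral_const_mul, integral_const_mul]
      _ ≤ (1 + η) * (Λ * ∫ x in Ω, u x ^ 2) + (1 + 1 / η) * D * ∫ x in Ω, u x ^ 2 := by
          gcongr
      _ = _ := by ring

lemma shell {d : ℕ} (hd : 0 < d) {Ω : Set (Euc d)} (hc : Convex ℝ Ω) (ho : IsOpen Ω)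
    (hb : Bornology.IsBounded Ω) {x0 : Euc d} (hx0 : x0 ∈ Ω) {t : ℝ} (ht : 1 < t) :
    (∀ x, t • x + (1 - t) • x0 ∈ closure Ω → x ∈ Ω) ∧
    ∃ p : Euc d, ∃ ρ > 0, Metric.ball p ρ ⊆ Ω ∧
      ∀ x ∈ Metric.ball p ρ, t • x + (1 - t) • x0 ∉ closure Ω := by
  have ht0 : 0 < t := by linarith
  have h1 : ∀ x, t • x + (1 - t) • x0 ∈ closure Ω → x ∈ Ω := by
    intro x hx
    have hx0' : x0 ∈ interior Ω := by rwa [ho.interior_eq]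
    have hti : t⁻¹ < 1 := inv_lt_one_of_one_lt₀ ht
    have := hc.combo_interior_closure_mem_interior hx0' hx (a := 1 - t⁻¹) (b := t⁻¹)
      (by linarith) (by positivity) (by ring)
    rw [ho.interior_eq] at this
    convert this using 1
    rw [smul_add, smul_smul, smul_smul, inv_mul_cancel₀ ht0.ne', one_smul]
    have : t⁻¹ * (1 - t) = t⁻¹ - 1 := by field_simp
    rw [this]
    module
  refine ⟨h1, ?_⟩
  have hcont : Continuous (fun x : Euc d => t • x + (1 - t) • x0) := by fun_prop
  set P := (fun x : Euc d => t • x + (1 - t) • x0) ⁻¹' closure Ω with hP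
  have hPc : IsClosed P := isClosed_closure.preimage hcont
  have hex : ∃ p ∈ Ω, p ∉ P := by
    by_contra hcon
    push Not at hcon
    have heq : Ω = P := Set.Subset.antisymm hcon h1
    have hcl : IsClopen Ω := ⟨by rw [heq]; exact hPc, ho⟩
    rcases isClopen_iff.1 hcl with h | h
    · rw [h] at hx0; exact hx0
    · have : Nonempty (Fin d) := ⟨⟨0, hd⟩⟩
      rw [h] at hb
      exact NormedSpace.unbounded_univ ℝ (Euc d) hb
  obtain ⟨p, hp, hpP⟩ := hex
  obtain ⟨ρ, hρ, hball⟩ := Metric.isOpen_iff.1 (ho.sdiff hPc) p ⟨hp, hpP⟩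
  exact ⟨p, ρ, hρ, fun x hx => (hball hx).1, fun x hx => (hball hx).2⟩

set_option maxHeartbeats 2000000 in
lemma key {d : ℕ} (hd : 0 < d) {Ω : Set (Euc d)} (hne : Ω.Nonempty) (hc : Convex ℝ Ω)
    (ho : IsOpen Ω) (hb : Bornology.IsBounded Ω) {ε : ℝ} (hε : 0 < ε) (hε1 : ε < 1) :
    ∃ K : ℕ, ∀ k ≥ K, ∀ Ω' : Set (Euc d), IsOpen Ω' → Bornology.IsBounded Ω' → Ω ⊆ Ω' →
    ∀ S : (Fin (k + 1) → ℝ) →ₗ[ℝ] (Euc d → ℝ), (∀ c, ContDiff ℝ (⊤ : ℕ∞) (S c)) →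
      (∀ c, c ≠ 0 → 0 < ∫ x in Ω, (S c x) ^ 2) →
      ∀ Λ : ℝ, (∀ c, ∫ x in Ω, ‖fderiv ℝ (S c) x‖ ^ 2 ≤ Λ * ∫ x in Ω, (S c x) ^ 2) →
      neumannEigenvalue k Ω' ≤ (1 + ε) * Λ := by
  obtain ⟨x0, hx0⟩ := hne
  set t : ℝ := 1 + ε / 8 with ht
  have ht1 : 1 < t := by rw [ht]; linarith
  set η : ℝ := ε / 10 with hη
  have hη0 : 0 < η := by positivity
  have hη1 : η < 1 := by rw [hη]; linarith
  have htη : t ^ 2 * (1 + 2 * η) ≤ (1 + ε) * (1 - η) := by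
    rw [ht, hη]; nlinarith [mul_pos hε hε, mul_pos (mul_pos hε hε) hε]
  obtain ⟨hin, p, ρ, hρ, hpΩ, hpout⟩ := shell hd hc ho hb hx0 ht1
  obtain ⟨R0, hR0, hbump⟩ := bumps d
  obtain ⟨a, ha, hbump⟩ := hbump p ρ hρ
  set c0 : ℝ := 2 ^ d * d with hc0
  have hc0' : 0 < c0 := by positivity
  set s1 := √(η / c0) with hs1
  have hs1p : 0 < s1 := by positivity
  have hs1sq : c0 * s1 ^ 2 = η := by rw [hs1, Real.sq_sqrt (by positivity)]; field_simp
  set l1 := √R0 with hl1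
  have hl1p : 0 < l1 := by positivity
  have hl1sq : l1 ^ 2 = R0 := Real.sq_sqrt hR0.le
  obtain ⟨χ, hχ, hχ01, hχc, hχΩ, L, hLΩ, hLm, hχL, s0, hs0, hcount⟩ :=
    exists_layer Ω hc ho hb ((a * s1 / l1) ^ d) (by positivity)
  obtain ⟨D0, hD0⟩ := (hχc.fderiv ℝ).exists_bound_of_continuous (hχ.continuous_fderiv (by simp))
  have hD : ∀ x, ‖fderiv ℝ χ x‖ ^ 2 ≤ D0 ^ 2 := fun x => by gcongr; exact hD0 x
  set D' := (1 + 1 / η) * D0 ^ 2 with hD'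
  have hD'0 : 0 ≤ D' := by positivity
  obtain ⟨K, hK⟩ := lam_large hc ho hb ((s1 / s0) ^ 2 + (l1 / a) ^ 2 + D' / η)
  refine ⟨K, fun k hk Ω' ho' hb' hΩΩ' S hS hpos Λ hΛ => ?_⟩
  have hM := hK k hk S hS hpos Λ hΛ
  have hp1 : 0 ≤ (s1 / s0) ^ 2 := by positivity
  have hp2 : 0 < (l1 / a) ^ 2 := by positivity
  have hp3 : 0 ≤ D' / η := by positivity
  have hΛ0 : 0 < Λ := by linarith
  have hσ : 0 < √Λ := by positivity
  have hσ2 : √Λ ^ 2 = Λ := Real.sq_sqrt hΛ0.le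
  have hσs : s1 / s0 ≤ √Λ := Real.le_sqrt_of_sq_le (by linarith)
  have hσl : l1 / a ≤ √Λ := Real.le_sqrt_of_sq_le (by linarith)
  have hDΛ : D' ≤ η * Λ := by
    have : D' / η ≤ Λ := by linarith
    rwa [div_le_iff₀ hη0, mul_comm] at this
  set s := s1 / √Λ with hs
  have hsp : 0 < s := by positivity
  set l := l1 / √Λ with hl
  have hlp : 0 < l := by positivity
  have hss0 : s ≤ s0 := by
    rw [hs, div_le_iff₀ hσ]; rw [div_le_iff₀ hs0] at hσs; linarith
  have hla : l ≤ a := by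
    rw [hl, div_le_iff₀ hσ]; rw [div_le_iff₀ ha] at hσl; linarith
  obtain ⟨J, hJ, hJc⟩ := hcount s hsp hss0
  obtain ⟨n, hn, b, hbs, hbt, hbd, hbN, hbG⟩ := hbump l hlp hla
  have hJn : J.card ≤ n ^ d := by
    have e : (a * s1 / l1) = (a / l) * s := by rw [hl, hs]; field_simp
    rw [e, mul_pow] at hJc
    have h1 : (J.card : ℝ) ≤ (a / l) ^ d := le_of_mul_le_mul_right hJc (by positivity)
    have h2 : (a / l) ^ d ≤ (n : ℝ) ^ d := by gcongr
    exact_mod_cast h1.trans h2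
  obtain ⟨E1, hE1, hE0⟩ := constraints hb S hS s J
  -- the first part of the test space
  set v := (1 - t) • x0 with hv
  let w : (Fin (k + 1) → ℝ) → Euc d → ℝ := fun e x => χ (t • x + v) * S e (t • x + v)
  have hws : ∀ e, ContDiff ℝ (⊤ : ℕ∞) (w e) := fun e => scale_smooth (hχ.mul (hS e)) t v
  have hwt : ∀ e x, x ∈ tsupport (w e) → t • x + v ∈ Ω := by
    intro e x hx
    have h1 := scale_tsupport (fun x => χ x * S e x) t v hx
    apply hχΩ
    exact tsupport_mul_subset_left h1
  have hwΩ : ∀ e, tsupport (w e) ⊆ Ω := fun e x hx => hin x (subset_closure (hwt e x hx))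
  have hw : ∀ e ∈ E1, (e ≠ 0 → 0 < ∫ x, w e x ^ 2) ∧
      ∫ x, ‖fderiv ℝ (w e) x‖ ^ 2 ≤ (1 + ε) * Λ * ∫ x, w e x ^ 2 := by
    intro e he
    have h1 := layer_poincare Ω hc ho hb hsp L hLΩ J hJ (S e) (hS e) (hE0 e he)
    have hN0 : 0 ≤ ∫ x in Ω, S e x ^ 2 := integral_nonneg fun x => by positivity
    have h2 : ∫ x in L, S e x ^ 2 ≤ η * ∫ x in Ω, S e x ^ 2 := by
      calc _ ≤ _ := h1
        _ ≤ c0 * s ^ 2 * (Λ * ∫ x in Ω, S e x ^ 2) := by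
            rw [← hc0]; gcongr; exact hΛ e
        _ = c0 * s1 ^ 2 * ∫ x in Ω, S e x ^ 2 := by
            rw [hs, div_pow, hσ2]; field_simp
        _ = _ := by rw [hs1sq]
    obtain ⟨h3, h4⟩ := cutoff ho hb hLm hLΩ hχ hχ01 hχΩ hχL (hS e) hη0 hD h2 (hΛ e)
    have e1 : ∫ x, w e x ^ 2 = (t ^ d)⁻¹ * ∫ x, (χ x * S e x) ^ 2 :=
      scale_int (fun x => (χ x * S e x) ^ 2) (by linarith) v
    have e2 : ∫ x, ‖fderiv ℝ (w e) x‖ ^ 2 =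
        t ^ 2 * ((t ^ d)⁻¹ * ∫ x, ‖fderiv ℝ (fun x => χ x * S e x) x‖ ^ 2) := by
      rw [← scale_int (fun x => ‖fderiv ℝ (fun x => χ x * S e x) x‖ ^ 2) (by linarith) v,
        ← integral_const_mul]
      congr 1; ext x
      exact scale_fderiv (hχ.mul (hS e)) v x
    have htd : 0 < (t ^ d)⁻¹ := by positivity
    constructor
    · intro hne
      rw [e1]
      have := hpos e hne
      have h5 : 0 < (1 - η) * ∫ x in Ω, S e x ^ 2 := mul_pos (by linarith) this
      have h6 : 0 < ∫ x, (χ x * S e x) ^ 2 := by linarith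
      positivity
    · rw [e1, e2]
      rw [← hD'] at h4
      set N := ∫ x in Ω, S e x ^ 2
      set N' := ∫ x, (χ x * S e x) ^ 2
      set G' := ∫ x, ‖fderiv ℝ (fun x => χ x * S e x) x‖ ^ 2
      have h5 : G' ≤ (1 + 2 * η) * Λ * N := by
        refine h4.trans ?_
        gcongr
        linarith
      have h6 : t ^ 2 * G' ≤ (1 + ε) * Λ * N' := by
        calc t ^ 2 * G' ≤ t ^ 2 * ((1 + 2 * η) * Λ * N) := by gcongr
          _ = (t ^ 2 * (1 + 2 * η)) * (Λ * N) := by ring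
          _ ≤ ((1 + ε) * (1 - η)) * (Λ * N) := by gcongr
          _ = (1 + ε) * Λ * ((1 - η) * N) := by ring
          _ ≤ _ := by gcongr
      calc t ^ 2 * ((t ^ d)⁻¹ * G') = (t ^ d)⁻¹ * (t ^ 2 * G') := by ring
        _ ≤ (t ^ d)⁻¹ * ((1 + ε) * Λ * N') := by gcongr
        _ = _ := by ring
  -- assemble
  let ι := Fin d → Fin n
  let f : E1 × (ι → ℝ) → Option ι → Euc d → ℝ := fun q o =>
    match o with
    | none => w q.1
    | some j => fun x => q.2 j * b j x
  have hfs : ∀ q o, ContDiff ℝ (⊤ : ℕ∞) (f q o) := by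
    rintro q (_ | j)
    · exact hws _
    · exact contDiff_const.mul (hbs j)
  have hfj : ∀ q j, tsupport (f q (some j)) ⊆ tsupport (b j) := fun q j => tsupport_cmul _ _
  have hft : ∀ q o, tsupport (f q o) ⊆ Ω' := by
    rintro q (_ | j)
    · exact (hwΩ _).trans hΩΩ'
    · exact (hfj q j).trans ((hbt j).trans (hpΩ.trans hΩΩ'))
  have hdis0 : ∀ q j, Disjoint (tsupport (f q none)) (tsupport (f q (some j))) := by
    intro q j
    rw [Set.disjoint_left]
    intro x hx hx'
    exact hpout x (hbt j (hfj q j hx')) (subset_closure (hwt _ x hx))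
  have hfd : ∀ q, Pairwise (fun i j => Disjoint (tsupport (f q i)) (tsupport (f q j))) := by
    rintro q (_ | i) (_ | j) hij
    · exact absurd rfl hij
    · exact hdis0 q j
    · exact (hdis0 q i).symm
    · exact (hbd (fun h => hij (by rw [h]))).mono (hfj q i) (hfj q j)
  let T : (E1 × (ι → ℝ)) →ₗ[ℝ] (Euc d → ℝ) :=
    { toFun := fun q x => ∑ o, f q o x
      map_add' := by
        intro q q'
        ext x
        simp only [Fintype.sum_option, f, w, Prod.fst_add, Prod.snd_add, Submodule.coe_add, map_add,
          Pi.add_apply, add_mul, mul_add, Finset.sum_add_distrib]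
        ring
      map_smul' := by
        intro r q
        ext x
        simp only [Fintype.sum_option, f, w, Prod.smul_fst, Prod.smul_snd, Submodule.coe_smul, map_smul,
          Pi.smul_apply, smul_eq_mul, RingHom.id_apply, mul_add, Finset.mul_sum]
        congr 1
        · ring
        · exact Finset.sum_congr rfl fun j _ => by ring }
  have hT : ∀ q, T q = fun x => ∑ o, f q o x := fun q => rfl
  have hray := fun q => disj_ray (f q) (hfs q) hb' (hfd q) (hft q)
  apply ev_le
  refine ev_upper k Ω' ho'.measurableSet (E := E1 × (ι → ℝ)) ?_ T ?_ ?_ _ (by positivity) ?_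
  · rw [Module.finrank_prod, Module.finrank_fintype_fun_eq_card]
    simp only [ι, Fintype.card_pi, Fintype.card_fin, Finset.prod_const, Finset.card_univ]
    omega
  · intro q
    rw [hT]
    exact ContDiff.sum fun o _ => hfs q o
  · rintro ⟨e, c⟩ hne
    rw [hT, (hray _).1]
    have hnn : ∀ o ∈ Finset.univ, 0 ≤ ∫ x, f (e, c) o x ^ 2 := fun o _ =>
      integral_nonneg fun x => by positivity
    apply Finset.sum_pos' hnn
    by_cases he : e = 0
    · have hcne : c ≠ 0 := fun h => hne (by rw [he, h]; rfl)
      obtain ⟨j, hj⟩ := Function.ne_iff.1 hcne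
      refine ⟨some j, Finset.mem_univ _, ?_⟩
      change 0 < ∫ x, (c j * b j x) ^ 2
      rw [(const_mul_int (hbs j) (c j)).1]
      have := hbN j
      have hj' : c j ≠ 0 := hj
      positivity
    · exact ⟨none, Finset.mem_univ _, (hw e e.2).1 (fun h => he (by ext1; exact h))⟩
  · intro q
    rw [hT, (hray q).1, (hray q).2, Finset.mul_sum]
    apply Finset.sum_le_sum
    rintro (_ | j) -
    · exact (hw q.1 q.1.2).2
    · change ∫ x, ‖fderiv ℝ (fun x => q.2 j * b j x) x‖ ^ 2 ≤ (1 + ε) * Λ * ∫ x, (q.2 j * b j x) ^ 2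
      rw [(const_mul_int (hbs j) _).1, (const_mul_int (hbs j) _).2]
      have h1 := hbG j
      have h2 : R0 / l ^ 2 = Λ := by
        rw [hl, div_pow, hσ2, hl1sq]; field_simp
      rw [h2] at h1
      have h3 : Λ ≤ (1 + ε) * Λ := by nlinarith
      have h4 := hbN j
      calc q.2 j ^ 2 * ∫ x, ‖fderiv ℝ (b j) x‖ ^ 2 ≤ q.2 j ^ 2 * ((1 + ε) * Λ * ∫ x, b j x ^ 2) := by
            gcongr
            exact h1.trans (by gcongr)
        _ = _ := by ring

lemma ev_nonempty {d : ℕ} (hd : 0 < d) {Ω : Set (Euc d)} (hne : Ω.Nonempty)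
    (ho : IsOpen Ω) (hb : Bornology.IsBounded Ω) (k : ℕ) :
    ∃ t : ℝ, ∃ V : Submodule ℝ (Euc d → ℝ),
    (∀ u ∈ V, ContDiff ℝ (⊤ : ℕ∞) u) ∧
    Module.finrank ℝ (V.map (LinearMap.funLeft ℝ ℝ ((↑) : Ω → Euc d))) = k + 1 ∧
    t = sSup { r : ℝ | ∃ u ∈ V, (0 < ∫ x in Ω, (u x) ^ 2) ∧ r = rayleigh Ω u } := by
  obtain ⟨p, hp⟩ := hne
  obtain ⟨ρ, hρ, hpΩ⟩ := Metric.isOpen_iff.1 ho p hp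
  obtain ⟨R0, hR0, hbump⟩ := bumps d
  obtain ⟨a, ha, hbump⟩ := hbump p ρ hρ
  set l := a / (k + 1) with hl
  have hlp : 0 < l := by positivity
  have hla : l ≤ a := by
    rw [hl]; apply div_le_self ha.le; linarith [(Nat.cast_nonneg k : (0:ℝ) ≤ k)]
  obtain ⟨n, hn, b, hbs, hbt, hbd, hbN, hbG⟩ := hbump l hlp hla
  have hkn : k + 1 ≤ n := by
    have : a / l = k + 1 := by rw [hl]; field_simp
    rw [this] at hn
    exact_mod_cast hn
  have hkn2 : k + 1 ≤ n ^ d := hkn.trans (Nat.le_self_pow hd.ne' n)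
  let ι := Fin d → Fin n
  let f : (ι → ℝ) → ι → Euc d → ℝ := fun q j x => q j * b j x
  have hfs : ∀ q o, ContDiff ℝ (⊤ : ℕ∞) (f q o) := fun q j => contDiff_const.mul (hbs j)
  have hfj : ∀ q j, tsupport (f q j) ⊆ tsupport (b j) := fun q j => tsupport_cmul _ _
  have hft : ∀ q o, tsupport (f q o) ⊆ Ω := fun q j => (hfj q j).trans ((hbt j).trans hpΩ)
  have hfd : ∀ q, Pairwise (fun i j => Disjoint (tsupport (f q i)) (tsupport (f q j))) :=
    fun q i j hij => (hbd hij).mono (hfj q i) (hfj q j)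
  let T : (ι → ℝ) →ₗ[ℝ] (Euc d → ℝ) :=
    { toFun := fun q x => ∑ o, f q o x
      map_add' := by
        intro q q'
        ext x
        simp only [f, Pi.add_apply, add_mul, Finset.sum_add_distrib]
      map_smul' := by
        intro r q
        ext x
        simp only [f, Pi.smul_apply, smul_eq_mul, RingHom.id_apply, Finset.mul_sum, mul_assoc] }
  have hT : ∀ q, T q = fun x => ∑ o, f q o x := fun q => rfl
  have hray := fun q => disj_ray (f q) (hfs q) hb (hfd q) (hft q)
  obtain ⟨t, -, h⟩ := ev_upper k Ω ho.measurableSet (E := ι → ℝ)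
    (by
      rw [Module.finrank_fintype_fun_eq_card]
      simpa only [ι, Fintype.card_pi, Fintype.card_fin, Finset.prod_const, Finset.card_univ] using hkn2)
    T (fun q => by rw [hT]; exact ContDiff.sum fun o _ => hfs q o)
    (by
      intro c hcne
      rw [hT, (hray _).1]
      apply Finset.sum_pos' (fun o _ => integral_nonneg fun x => by positivity)
      obtain ⟨j, hj⟩ := Function.ne_iff.1 hcne
      refine ⟨j, Finset.mem_univ _, ?_⟩
      change 0 < ∫ x, (c j * b j x) ^ 2
      rw [(const_mul_int (hbs j) (c j)).1]
      have := hbN j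
      have hj' : c j ≠ 0 := hj
      positivity)
    (R0 / l ^ 2) (by positivity)
    (by
      intro q
      rw [hT, (hray q).1, (hray q).2, Finset.mul_sum]
      apply Finset.sum_le_sum
      rintro j -
      change ∫ x, ‖fderiv ℝ (fun x => q j * b j x) x‖ ^ 2 ≤ R0 / l ^ 2 * ∫ x, (q j * b j x) ^ 2
      rw [(const_mul_int (hbs j) _).1, (const_mul_int (hbs j) _).2]
      calc q j ^ 2 * ∫ x, ‖fderiv ℝ (b j) x‖ ^ 2 ≤ q j ^ 2 * (R0 / l ^ 2 * ∫ x, b j x ^ 2) := by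
            gcongr
            exact hbG j
        _ = _ := by ring)
  exact ⟨t, h⟩

lemma main_small {d : ℕ} (hd : 0 < d) {Ω : Set (Euc d)} (hΩ : IsConvexDomain Ω)
    (Ωs : ℕ → Set (Euc d))
    (hΩs : ∀ k : ℕ, 1 ≤ k → IsOpen (Ωs k) ∧ Bornology.IsBounded (Ωs k) ∧ Ω ⊆ Ωs k)
    {ε : ℝ} (hε : 0 < ε) (hε1 : ε < 1) : ∃ K : ℕ, ∀ k : ℕ, K ≤ k →
      0 ≤ neumannEigenvalue k (Ωs k) ∧
      (1 - ε) * neumannEigenvalue k (Ωs k) ≤ neumannEigenvalue k Ω := by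
  obtain ⟨hne, ho, hb, hc⟩ := hΩ
  obtain ⟨K, hK⟩ := key hd hne hc ho hb hε hε1
  refine ⟨K + 1, fun k hk => ?_⟩
  obtain ⟨ho', hb', hsub⟩ := hΩs k (by omega)
  have hnn : 0 ≤ neumannEigenvalue k (Ωs k) := by
    apply Real.sInf_nonneg
    rintro t ⟨V, -, -, rfl⟩
    apply Real.sSup_nonneg
    rintro r ⟨u, -, -, rfl⟩
    exact ev_nonneg _ _
  refine ⟨hnn, ?_⟩
  apply le_csInf
  · obtain ⟨t, ht⟩ := ev_nonempty hd hne ho hb k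
    exact ⟨t, ht⟩
  · rintro Λ ⟨V, hV, hr, hΛ⟩
    obtain ⟨S, hS, hpos, hG⟩ := ev_lower k ho hb V hV hr
    rw [← hΛ] at hG
    have h := hK k (by omega) (Ωs k) ho' hb' hsub S hS hpos Λ hG
    have hΛ0 : 0 ≤ Λ := by
      rw [hΛ]
      apply Real.sSup_nonneg
      rintro r ⟨u, -, -, rfl⟩
      exact ev_nonneg _ _
    calc (1 - ε) * neumannEigenvalue k (Ωs k) ≤ (1 - ε) * ((1 + ε) * Λ) :=
          mul_le_mul_of_nonneg_left h (by linarith)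
      _ ≤ Λ := by nlinarith [mul_nonneg (sq_nonneg ε) hΛ0]

/-- asymptotic domain quasi-monotonicity with a fixed inner domain: if `Ω` is a
nonempty bounded convex open set and `Ω ⊆ Ω_k` with each `Ω_k` bounded and open, then
`liminf_{k→∞} μ_k(Ω)/μ_k(Ω_k) ≥ 1`; precisely, for every `ε > 0` there is `K` such that
`μ_k(Ω) ≥ (1-ε) μ_k(Ω_k)` for all `k ≥ K`. -/
theorem fixed_inner_domain_asymptotic_monotonicity
    (d : ℕ) (hd : 2 ≤ d) (Ω : Set (Euc d)) (hΩ : IsConvexDomain Ω)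
    (Ωs : ℕ → Set (Euc d))
    (hΩs : ∀ k : ℕ, 1 ≤ k → IsOpen (Ωs k) ∧ Bornology.IsBounded (Ωs k) ∧ Ω ⊆ Ωs k) :
    ∀ ε : ℝ, 0 < ε → ∃ K : ℕ, ∀ k : ℕ, K ≤ k →
      neumannEigenvalue k Ω ≥ (1 - ε) * neumannEigenvalue k (Ωs k) := by
  intro ε hε
  obtain ⟨K, hK⟩ := main_small (by omega) hΩ Ωs hΩs (ε := min ε (1 / 2)) (by positivity)
    (lt_of_le_of_lt (min_le_right _ _) (by norm_num))
  refine ⟨K, fun k hk => ?_⟩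
  obtain ⟨h1, h2⟩ := hK k hk
  have h3 : (1 - ε) * neumannEigenvalue k (Ωs k) ≤
      (1 - min ε (1 / 2)) * neumannEigenvalue k (Ωs k) := by
    gcongr
    exact min_le_left _ _
  exact h3.trans h2

end
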